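/- arXiv:2505.20337 — 4 statements merged into one kernel-verified Lean document; each statement's English description precedes it below -/
import Mathlib

section
/- Let N, L ≥ 1. Suppose the data entries x_{l,n,i} (l ∈ [L], n ∈ [N], i ∈ [3]) are independent real Gaussian random variables, x_{l,n,i} ~ N(μ_{l,n,i}, σ_{l,n,i}²), with σ_{l,n,i}² ≥ σ² for some σ² > 0. Let U_1, …, U_L be arbitrary 2^N × 2^N unitary matrices, and let ρ(x) = (U_L R_L(x_{[L]}) ⋯ U_1 R_1(x_{[1]})) ρ₀ (U_L R_L(x_{[L]}) ⋯ U_1 R_1(x_{[1]}))† be the encoded state, where ρ₀ = (|0⟩⟨0|)^{⊗N}. Let E[ρ] denote the entrywise expectation of ρ(x) over the product Gaussian measure. Then the Petz–Rényi-2 divergence from E[ρ] to the maximally mixed state ρ_I = I/2^N satisfies D₂(E[ρ] ‖ ρ_I) ≤ log₂(1 + (2^N − 1)·e^{−L·σ²}); equivalently, 2^N · Tr[(E[ρ])²] ≤ 1 + (2^N − 1)·e^{−L·σ²}. -/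
open Matrix MeasureTheory ProbabilityTheory
open scoped NNReal ENNReal ComplexOrder

noncomputable section

/-- Pauli X matrix. -/
def PX : Matrix (Fin 2) (Fin 2) ℂ := !![0, 1; 1, 0]

/-- Pauli Y matrix. -/
def PY : Matrix (Fin 2) (Fin 2) ℂ := !![0, -Complex.I; Complex.I, 0]

/-- Pauli Z matrix. -/
def PZ : Matrix (Fin 2) (Fin 2) ℂ := !![1, 0; 0, -1]

/-- Rotation gate `exp(-i·x·P/2) = cos(x/2)·I - i·sin(x/2)·P` for a Pauli matrix `P`. -/
def rotG (P : Matrix (Fin 2) (Fin 2) ℂ) (x : ℝ) : Matrix (Fin 2) (Fin 2) ℂ :=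
  (Real.cos (x / 2) : ℂ) • (1 : Matrix (Fin 2) (Fin 2) ℂ)
    - (Complex.I * (Real.sin (x / 2) : ℂ)) • P

/-- `R_z` rotation gate. -/
def Rz (x : ℝ) : Matrix (Fin 2) (Fin 2) ℂ := rotG PZ x

/-- `R_y` rotation gate. -/
def Ry (x : ℝ) : Matrix (Fin 2) (Fin 2) ℂ := rotG PY x

/-- Single-qubit encoding gate `R(v) = R_z(v₃) R_y(v₂) R_z(v₁)`. -/
def encGate (v : Fin 3 → ℝ) : Matrix (Fin 2) (Fin 2) ℂ :=
  Rz (v 2) * Ry (v 1) * Rz (v 0)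

/-- Kronecker product of a family of `2 × 2` matrices, indexed by `Fin N → Fin 2`. -/
def kron {N : ℕ} (A : Fin N → Matrix (Fin 2) (Fin 2) ℂ) :
    Matrix (Fin N → Fin 2) (Fin N → Fin 2) ℂ :=
  Matrix.of fun i j => ∏ n, A n (i n) (j n)

/-- Encoding-layer gate `R_l(x_{[l]}) = ⊗ₙ R(x_{l,n})`. -/
def layerGate {N : ℕ} (x : Fin N → Fin 3 → ℝ) :
    Matrix (Fin N → Fin 2) (Fin N → Fin 2) ℂ :=
  kron fun n => encGate (x n)

/-- `|0⟩⟨0|`. -/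
def ket0 : Matrix (Fin 2) (Fin 2) ℂ := !![1, 0; 0, 0]

/-- The initial state `ρ₀ = (|0⟩⟨0|)^{⊗N}`. -/
def rho0 (N : ℕ) : Matrix (Fin N → Fin 2) (Fin N → Fin 2) ℂ := kron fun _ => ket0

/-- Squared Frobenius norm of a complex matrix. -/
def frobSq {n : Type*} [Fintype n] (A : Matrix n n ℂ) : ℝ := ∑ i, ∑ j, ‖A i j‖ ^ 2

theorem norm_sq_sum_le_card {n : Type*} [Fintype n] (a : n → ℂ) :
    ‖∑ i, a i‖ ^ 2 ≤ Fintype.card n * ∑ i, ‖a i‖ ^ 2 := by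
  calc ‖∑ i, a i‖ ^ 2 ≤ (∑ i, ‖a i‖) ^ 2 := by gcongr; exact norm_sum_le _ _
    _ ≤ _ := by simpa using sq_sum_le_card_mul_sum_sq (s := Finset.univ) (f := fun i => ‖a i‖)

theorem norm_sq_trace_le {n : Type*} [Fintype n] (A : Matrix n n ℂ) :
    ‖A.trace‖ ^ 2 ≤ Fintype.card n * frobSq A := by
  refine (norm_sq_sum_le_card _).trans ?_
  unfold frobSq
  gcongr with i
  exact Finset.single_le_sum (f := fun j => ‖A i j‖ ^ 2) (fun _ _ => by positivity)
    (Finset.mem_univ i)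

theorem norm_sq_add_norm_sq (a b : ℂ) :
    ‖a‖ ^ 2 + ‖b‖ ^ 2 = (‖a + b‖ ^ 2 + ‖a - b‖ ^ 2) / 2 := by
  simp only [← Complex.normSq_eq_norm_sq, Complex.normSq_apply, Complex.add_re, Complex.add_im,
    Complex.sub_re, Complex.sub_im]
  ring

theorem sum_finCons {N : ℕ} {M : Type*} [AddCommMonoid M] (f : (Fin (N + 1) → Fin 2) → M) :
    ∑ s, f s = ∑ a, ∑ t : Fin N → Fin 2, f (Fin.cons a t) := by
  rw [← Fintype.sum_prod_type', ← (Fin.consEquiv fun _ => Fin 2).sum_comp]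
  rfl

/-- The superoperator on `N`-qubit matrices that is the tensor product of single-qubit
superoperators `S n`, with `S n i j k l` the coefficient of entry `(k, l)` of the input
in entry `(i, j)` of the output. -/
def tensorMap {N : ℕ} (S : Fin N → Fin 2 → Fin 2 → Fin 2 → Fin 2 → ℂ)
    (A : Matrix (Fin N → Fin 2) (Fin N → Fin 2) ℂ) :
    Matrix (Fin N → Fin 2) (Fin N → Fin 2) ℂ :=
  Matrix.of fun i j => ∑ k, ∑ l, (∏ n, S n (i n) (j n) (k n) (l n)) * A k l

theorem tensorMap_add {N : ℕ} (S : Fin N → Fin 2 → Fin 2 → Fin 2 → Fin 2 → ℂ)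
    (A B : Matrix (Fin N → Fin 2) (Fin N → Fin 2) ℂ) :
    tensorMap S (A + B) = tensorMap S A + tensorMap S B := by
  ext i j
  simp [tensorMap, mul_add, Finset.sum_add_distrib]

theorem tensorMap_sub {N : ℕ} (S : Fin N → Fin 2 → Fin 2 → Fin 2 → Fin 2 → ℂ)
    (A B : Matrix (Fin N → Fin 2) (Fin N → Fin 2) ℂ) :
    tensorMap S (A - B) = tensorMap S A - tensorMap S B := by
  ext i j
  simp [tensorMap, mul_sub, Finset.sum_sub_distrib]

/-- The block of a matrix obtained by fixing the row and column indices of the first qubit. -/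
def headBlock {N : ℕ} (A : Matrix (Fin (N + 1) → Fin 2) (Fin (N + 1) → Fin 2) ℂ) (k l : Fin 2) :
    Matrix (Fin N → Fin 2) (Fin N → Fin 2) ℂ :=
  Matrix.of fun s t => A (Fin.cons k s) (Fin.cons l t)

theorem tensorMap_cons {N : ℕ} (S : Fin (N + 1) → Fin 2 → Fin 2 → Fin 2 → Fin 2 → ℂ)
    (A : Matrix (Fin (N + 1) → Fin 2) (Fin (N + 1) → Fin 2) ℂ) (i j : Fin 2)
    (s t : Fin N → Fin 2) :
    tensorMap S A (Fin.cons i s) (Fin.cons j t) =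
      ∑ k, ∑ l, S 0 i j k l * tensorMap (fun n => S n.succ) (headBlock A k l) s t := by
  simp only [tensorMap, headBlock, Matrix.of_apply, sum_finCons, Fin.prod_univ_succ, Fin.cons_zero,
    Fin.cons_succ, Finset.mul_sum]
  refine Finset.sum_congr rfl fun k _ => ?_
  rw [Finset.sum_comm]
  refine Finset.sum_congr rfl fun l _ => Finset.sum_congr rfl fun k' _ =>
    Finset.sum_congr rfl fun l' _ => by ring

theorem frobSq_eq_sum_headBlock {N : ℕ}
    (A : Matrix (Fin (N + 1) → Fin 2) (Fin (N + 1) → Fin 2) ℂ) :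
    frobSq A = ∑ k, ∑ l, frobSq (headBlock A k l) := by
  simp only [frobSq, headBlock, Matrix.of_apply, sum_finCons]
  refine Finset.sum_congr rfl fun k _ => ?_
  rw [Finset.sum_comm]

theorem trace_eq_trace_headBlock {N : ℕ}
    (A : Matrix (Fin (N + 1) → Fin 2) (Fin (N + 1) → Fin 2) ℂ) :
    A.trace = (headBlock A 0 0 + headBlock A 1 1).trace := by
  simp [Matrix.trace, headBlock, sum_finCons, Finset.sum_add_distrib]

theorem frobSq_add_frobSq {n : Type*} [Fintype n] (A B : Matrix n n ℂ) :
    frobSq A + frobSq B = (frobSq (A + B) + frobSq (A - B)) / 2 := by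
  simp only [frobSq, ← Finset.sum_add_distrib, Finset.sum_div, Matrix.add_apply, Matrix.sub_apply]
  exact Finset.sum_congr rfl fun i _ => Finset.sum_congr rfl fun j _ => norm_sq_add_norm_sq _ _

/-- A tensor product of single-qubit superoperators, each of which is a contraction on the
trace part and shrinks the squared norm of the traceless part by `c`, shrinks the squared norm of
the traceless part by `c`. -/
theorem frobSq_tensorMap_le {c : ℝ} (hc0 : 0 ≤ c) (hc1 : c ≤ 1) {N : ℕ}
    (S : Fin N → Fin 2 → Fin 2 → Fin 2 → Fin 2 → ℂ)
    (hS : ∀ n (b : Matrix (Fin 2) (Fin 2) ℂ), ∑ i, ∑ j, ‖∑ k, ∑ l, S n i j k l * b k l‖ ^ 2 ≤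
      ‖b 0 0 + b 1 1‖ ^ 2 / 2 +
        c * (‖b 0 1‖ ^ 2 + ‖b 1 0‖ ^ 2 + ‖b 0 0 - b 1 1‖ ^ 2 / 2))
    (A : Matrix (Fin N → Fin 2) (Fin N → Fin 2) ℂ) :
    2 ^ N * frobSq (tensorMap S A) ≤ (1 - c) * ‖A.trace‖ ^ 2 + c * (2 ^ N * frobSq A) := by
  induction N with
  | zero =>
    simp only [frobSq, tensorMap, Matrix.trace, Matrix.diag, Matrix.of_apply,
      Fintype.sum_unique, Finset.univ_eq_empty, Finset.prod_empty, pow_zero, one_mul]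
    linarith
  | succ N ih =>
    set T := fun n : Fin N => S n.succ
    have ihT := ih T fun n => hS n.succ
    have contr (B) : frobSq (tensorMap T B) ≤ frobSq B := by
      have h := ihT B
      have h2 := norm_sq_trace_le B
      simp only [Fintype.card_fun, Fintype.card_fin, Nat.cast_pow, Nat.cast_ofNat] at h2
      have h3 : (2 : ℝ) ^ N * frobSq (tensorMap T B) ≤ 2 ^ N * frobSq B := by
        nlinarith [mul_le_mul_of_nonneg_left h2 (sub_nonneg.2 hc1)]
      exact le_of_mul_le_mul_left h3 (by positivity)
    have key : frobSq (tensorMap S A) ≤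
        frobSq (tensorMap T (headBlock A 0 0 + headBlock A 1 1)) / 2 +
          c * (frobSq (tensorMap T (headBlock A 0 1)) + frobSq (tensorMap T (headBlock A 1 0)) +
            frobSq (tensorMap T (headBlock A 0 0 - headBlock A 1 1)) / 2) := by
      have e1 : frobSq (tensorMap S A) = ∑ s, ∑ t, ∑ i, ∑ j,
          ‖∑ k, ∑ l, S 0 i j k l * tensorMap T (headBlock A k l) s t‖ ^ 2 := by
        simp only [frobSq, sum_finCons, tensorMap_cons]
        rw [Finset.sum_comm]
        refine Finset.sum_congr rfl fun s _ => ?_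
        exact (Finset.sum_congr rfl fun j _ => Finset.sum_comm).trans Finset.sum_comm
      rw [e1, tensorMap_add, tensorMap_sub]
      simp only [frobSq, Finset.sum_div, Finset.mul_sum, ← Finset.sum_add_distrib,
        Matrix.add_apply, Matrix.sub_apply]
      exact Finset.sum_le_sum fun s _ => Finset.sum_le_sum fun t _ =>
        hS 0 (Matrix.of fun k l => tensorMap T (headBlock A k l) s t)
    have h1 := ihT (headBlock A 0 0 + headBlock A 1 1)
    rw [← trace_eq_trace_headBlock] at h1
    have h2 := contr (headBlock A 0 1)
    have h3 := contr (headBlock A 1 0)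
    have h4 := contr (headBlock A 0 0 - headBlock A 1 1)
    have h5 := frobSq_add_frobSq (headBlock A 0 0) (headBlock A 1 1)
    have h6 := frobSq_eq_sum_headBlock A
    simp only [Fin.sum_univ_two] at h6
    have h7 : c * (frobSq (tensorMap T (headBlock A 0 1)) + frobSq (tensorMap T (headBlock A 1 0)) +
            frobSq (tensorMap T (headBlock A 0 0 - headBlock A 1 1)) / 2) ≤
          c * (frobSq A - frobSq (headBlock A 0 0 + headBlock A 1 1) / 2) :=
      mul_le_mul_of_nonneg_left (by linarith) hc0
    calc 2 ^ (N + 1) * frobSq (tensorMap S A) ≤ 2 ^ (N + 1) *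
        (frobSq (tensorMap T (headBlock A 0 0 + headBlock A 1 1)) / 2 +
          c * (frobSq A - frobSq (headBlock A 0 0 + headBlock A 1 1) / 2)) := by
          gcongr; linarith
      _ ≤ _ := by rw [pow_succ]; linarith

/-- The action of `R_z` by conjugation, with `w = (1, cos φ, sin φ)`, extended linearly in `w`. -/
def zMap (w : Fin 3 → ℂ) (b : Matrix (Fin 2) (Fin 2) ℂ) : Matrix (Fin 2) (Fin 2) ℂ :=
  !![w 0 * b 0 0, (w 1 - Complex.I * w 2) * b 0 1;
    (w 1 + Complex.I * w 2) * b 1 0, w 0 * b 1 1]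

/-- The action of `R_y` by conjugation, with `w = (1, cos φ, sin φ)`, extended linearly in `w`. -/
def yMap (w : Fin 3 → ℂ) (b : Matrix (Fin 2) (Fin 2) ℂ) : Matrix (Fin 2) (Fin 2) ℂ :=
  let t := w 0 * (b 0 0 + b 1 1)
  let y := w 0 * (b 0 1 - b 1 0)
  let z := w 1 * (b 0 0 - b 1 1) - w 2 * (b 0 1 + b 1 0)
  let x := w 1 * (b 0 1 + b 1 0) + w 2 * (b 0 0 - b 1 1)
  !![(t + z) / 2, (x + y) / 2; (x - y) / 2, (t - z) / 2]

/-- The action of the encoding gate by conjugation, extended multilinearly. -/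
def encMap (w : Fin 3 → Fin 3 → ℂ) (b : Matrix (Fin 2) (Fin 2) ℂ) : Matrix (Fin 2) (Fin 2) ℂ :=
  zMap (w 2) (yMap (w 1) (zMap (w 0) b))

/-- The trigonometric vector `(1, cos φ, sin φ)`. -/
def trigVec (φ : ℝ) : Fin 3 → ℂ := ![1, (Real.cos φ : ℂ), (Real.sin φ : ℂ)]

theorem ofReal_cos_sq_half (φ : ℝ) :
    (Real.cos (φ / 2) : ℂ) ^ 2 = (1 + (Real.cos φ : ℂ)) / 2 := by
  have h := Real.cos_sq (φ / 2)
  rw [show 2 * (φ / 2) = φ by ring] at h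
  rw [← Complex.ofReal_pow, h]
  push_cast
  ring

theorem ofReal_sin_sq_half (φ : ℝ) :
    (Real.sin (φ / 2) : ℂ) ^ 2 = (1 - (Real.cos φ : ℂ)) / 2 := by
  rw [← Complex.ofReal_pow, Real.sin_sq, Complex.ofReal_sub, Complex.ofReal_pow,
    ofReal_cos_sq_half, Complex.ofReal_one]
  ring

theorem ofReal_sin_mul_cos_half (φ : ℝ) :
    (Real.sin (φ / 2) : ℂ) * (Real.cos (φ / 2) : ℂ) = (Real.sin φ : ℂ) / 2 := by
  have h := Real.sin_two_mul (φ / 2)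
  rw [show 2 * (φ / 2) = φ by ring] at h
  rw [h]
  push_cast
  ring

theorem Rz_conj (φ : ℝ) (b : Matrix (Fin 2) (Fin 2) ℂ) :
    Rz φ * b * (Rz φ)ᴴ = zMap (trigVec φ) b := by
  have hc := ofReal_cos_sq_half φ
  have hs := ofReal_sin_sq_half φ
  have hsc := ofReal_sin_mul_cos_half φ
  have hI := Complex.I_sq
  have hstar : ∀ r : ℝ, (starRingEnd ℂ) (r : ℂ) = r := Complex.conj_ofReal
  ext i j
  fin_cases i <;> fin_cases j <;>
    simp [-Complex.ofReal_cos, -Complex.ofReal_sin, hstar, Rz, rotG, PZ, zMap, trigVec,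
      Matrix.mul_apply, Fin.sum_univ_two]
  · linear_combination b 0 0 * (hc + hs) - Real.sin (φ / 2) ^ 2 * b 0 0 * hI
  · linear_combination
      b 0 1 * (hc - hs - 2 * Complex.I * hsc) + Real.sin (φ / 2) ^ 2 * b 0 1 * hI
  · linear_combination
      b 1 0 * (hc - hs + 2 * Complex.I * hsc) + Real.sin (φ / 2) ^ 2 * b 1 0 * hI
  · linear_combination b 1 1 * (hc + hs) - Real.sin (φ / 2) ^ 2 * b 1 1 * hI

theorem Ry_conj (φ : ℝ) (b : Matrix (Fin 2) (Fin 2) ℂ) :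
    Ry φ * b * (Ry φ)ᴴ = yMap (trigVec φ) b := by
  have hc := ofReal_cos_sq_half φ
  have hs := ofReal_sin_sq_half φ
  have hsc := ofReal_sin_mul_cos_half φ
  have hstar : ∀ r : ℝ, (starRingEnd ℂ) (r : ℂ) = r := Complex.conj_ofReal
  have hRy : Ry φ = !![(Real.cos (φ / 2) : ℂ), -(Real.sin (φ / 2) : ℂ);
      (Real.sin (φ / 2) : ℂ), (Real.cos (φ / 2) : ℂ)] := by
    ext i j
    fin_cases i <;> fin_cases j <;>
      simp [-Complex.ofReal_cos, -Complex.ofReal_sin, Ry, rotG, PY, mul_right_comm]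
  rw [hRy]
  ext i j
  fin_cases i <;> fin_cases j <;>
    simp [-Complex.ofReal_cos, -Complex.ofReal_sin, hstar, yMap, trigVec,
      Matrix.mul_apply, Matrix.vecMul, dotProduct, Fin.sum_univ_two]
  · linear_combination b 0 0 * hc + b 1 1 * hs - (b 0 1 + b 1 0) * hsc
  · linear_combination b 0 1 * hc - b 1 0 * hs + (b 0 0 - b 1 1) * hsc
  · linear_combination b 1 0 * hc - b 0 1 * hs + (b 0 0 - b 1 1) * hsc
  · linear_combination b 1 1 * hc + b 0 0 * hs + (b 0 1 + b 1 0) * hsc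

theorem encGate_conj (x : Fin 3 → ℝ) (b : Matrix (Fin 2) (Fin 2) ℂ) :
    encGate x * b * (encGate x)ᴴ = encMap (fun i => trigVec (x i)) b := by
  rw [encMap, ← Rz_conj, ← Ry_conj, ← Rz_conj, encGate]
  simp only [Matrix.conjTranspose_mul, Matrix.mul_assoc]

theorem encMap_eq_sum (w : Fin 3 → Fin 3 → ℂ) (b : Matrix (Fin 2) (Fin 2) ℂ) (i j : Fin 2) :
    encMap w b i j = ∑ p : Fin 3 → Fin 3,
      (∏ k, w k (p k)) * encMap (fun k => Pi.single (p k) 1) b i j := by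
  have e : ∀ f : (Fin 3 → Fin 3) → ℂ, ∑ p, f p = ∑ a, ∑ b, ∑ c, f ![a, b, c] := fun f => by
    rw [← (Fin.consEquiv fun _ => Fin 3).sum_comp, Fintype.sum_prod_type]
    refine Finset.sum_congr rfl fun a _ => ?_
    rw [← (Fin.consEquiv fun _ => Fin 3).sum_comp, Fintype.sum_prod_type]
    refine Finset.sum_congr rfl fun a _ => ?_
    rw [← (Fin.consEquiv fun _ => Fin 3).sum_comp, Fintype.sum_prod_type]
    refine Finset.sum_congr rfl fun a _ => ?_
    simp only [Fintype.sum_unique]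
    rfl
  rw [e]
  fin_cases i <;> fin_cases j <;>
  · simp [encMap, zMap, yMap, Fin.sum_univ_three, Fin.prod_univ_three, Pi.single_apply]
    ring

/-- The mean of `trigVec` under a Gaussian. -/
def meanVec (μ : ℝ) (v : ℝ≥0) : Fin 3 → ℂ :=
  ![1, (Real.exp (-v / 2) * Real.cos μ : ℝ), (Real.exp (-v / 2) * Real.sin μ : ℝ)]

theorem continuous_trigVec (a : Fin 3) : Continuous fun φ => trigVec φ a := by
  fin_cases a <;> simp [trigVec] <;> fun_prop

theorem norm_trigVec_le (φ : ℝ) (a : Fin 3) : ‖trigVec φ a‖ ≤ 1 := by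
  fin_cases a
  · simp [trigVec]
  · simpa [trigVec, -Complex.ofReal_cos] using Real.abs_cos_le_one φ
  · simpa [trigVec, -Complex.ofReal_sin] using Real.abs_sin_le_one φ

theorem integrable_trigVec (ν : Measure ℝ) [IsFiniteMeasure ν] (a : Fin 3) :
    Integrable (fun φ => trigVec φ a) ν :=
  .of_bound (continuous_trigVec a).aestronglyMeasurable 1 (.of_forall fun φ => norm_trigVec_le φ a)

theorem integral_trigVec (μ : ℝ) (v : ℝ≥0) (a : Fin 3) :
    ∫ φ, trigVec φ a ∂gaussianReal μ v = meanVec μ v a := by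
  have h := charFun_gaussianReal (μ := μ) (v := v) 1
  rw [charFun_apply_real] at h
  have hpt : ∀ φ : ℝ, Complex.exp (((1 : ℝ) : ℂ) * φ * Complex.I) =
      trigVec φ 1 + trigVec φ 2 * Complex.I := fun φ => by
    simp [trigVec, Complex.exp_mul_I]
  have hexp : Complex.exp (((1 : ℝ) : ℂ) * μ * Complex.I - v * ((1 : ℝ) : ℂ) ^ 2 / 2) =
      meanVec μ v 1 + meanVec μ v 2 * Complex.I := by
    rw [show ((1 : ℝ) : ℂ) * μ * Complex.I - v * ((1 : ℝ) : ℂ) ^ 2 / 2 =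
      -v / 2 + μ * Complex.I by push_cast; ring, Complex.exp_add, Complex.exp_mul_I]
    simp [meanVec]
    ring
  simp_rw [hpt] at h
  rw [hexp, integral_add (integrable_trigVec _ _) ((integrable_trigVec _ _).mul_const _),
    integral_mul_const] at h
  have h1 : ∫ φ, trigVec φ 1 ∂gaussianReal μ v = (∫ φ, Real.cos φ ∂gaussianReal μ v : ℝ) :=
    integral_ofReal
  have h2 : ∫ φ, trigVec φ 2 ∂gaussianReal μ v = (∫ φ, Real.sin φ ∂gaussianReal μ v : ℝ) :=
    integral_ofReal
  have m1 : meanVec μ v 1 = (Real.exp (-v / 2) * Real.cos μ : ℝ) := rfl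
  have m2 : meanVec μ v 2 = (Real.exp (-v / 2) * Real.sin μ : ℝ) := rfl
  rw [h1, h2, m1, m2] at h
  fin_cases a
  · simp [trigVec, meanVec]
  · exact h1.trans (congrArg _ (by simpa [-Complex.ofReal_mul] using congrArg Complex.re h))
  · exact h2.trans (congrArg _ (by simpa [-Complex.ofReal_mul] using congrArg Complex.im h))

theorem integral_encMap (μ : Fin 3 → ℝ) (v : Fin 3 → ℝ≥0) (b : Matrix (Fin 2) (Fin 2) ℂ)
    (i j : Fin 2) :
    ∫ x, encMap (fun k => trigVec (x k)) b i j ∂Measure.pi (fun k => gaussianReal (μ k) (v k)) =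
      encMap (fun k => meanVec (μ k) (v k)) b i j := by
  simp_rw [encMap_eq_sum (fun k => trigVec _), encMap_eq_sum (fun k => meanVec _ _)]
  rw [integral_finsetSum]
  · refine Finset.sum_congr rfl fun p _ => ?_
    rw [integral_mul_const, integral_fintype_prod_eq_prod (fun k φ => trigVec φ (p k))]
    simp_rw [integral_trigVec]
  · intro p _
    exact (Integrable.fintype_prod_dep (f := fun k φ => trigVec φ (p k))
      fun k => integrable_trigVec _ _).mul_const _

theorem meanVec_norm_sq {μ : ℝ} {v : ℝ≥0} :
    (Real.exp (-v / 2) * Real.cos μ) ^ 2 + (Real.exp (-v / 2) * Real.sin μ) ^ 2 =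
      Real.exp (-v) := by
  rw [mul_pow, mul_pow, ← mul_add, Real.cos_sq_add_sin_sq, mul_one, ← Real.exp_nat_mul]
  congr 1
  push_cast
  ring

theorem sum_norm_sq_fin_two (b : Matrix (Fin 2) (Fin 2) ℂ) :
    ∑ i, ∑ j, ‖b i j‖ ^ 2 = (‖b 0 0 + b 1 1‖ ^ 2 + ‖b 0 0 - b 1 1‖ ^ 2 +
      (‖b 0 1 + b 1 0‖ ^ 2 + ‖b 0 1 - b 1 0‖ ^ 2)) / 2 := by
  have h1 := norm_sq_add_norm_sq (b 0 0) (b 1 1)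
  have h2 := norm_sq_add_norm_sq (b 0 1) (b 1 0)
  simp only [Fin.sum_univ_two]
  linarith

theorem norm_sq_rotate (C S : ℝ) (x z : ℂ) :
    ‖C * x + S * z‖ ^ 2 + ‖C * z - S * x‖ ^ 2 = (C ^ 2 + S ^ 2) * (‖x‖ ^ 2 + ‖z‖ ^ 2) := by
  simp only [← Complex.normSq_eq_norm_sq, Complex.normSq_apply, Complex.add_re, Complex.add_im,
    Complex.sub_re, Complex.sub_im, Complex.re_ofReal_mul, Complex.im_ofReal_mul]
  ring

theorem zMap_norm_sq (C S : ℝ) (b : Matrix (Fin 2) (Fin 2) ℂ) :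
    ‖zMap ![1, (C : ℂ), (S : ℂ)] b 0 1 + zMap ![1, (C : ℂ), (S : ℂ)] b 1 0‖ ^ 2 +
      ‖zMap ![1, (C : ℂ), (S : ℂ)] b 0 1 - zMap ![1, (C : ℂ), (S : ℂ)] b 1 0‖ ^ 2 =
      (C ^ 2 + S ^ 2) * (‖b 0 1 + b 1 0‖ ^ 2 + ‖b 0 1 - b 1 0‖ ^ 2) := by
  simp only [zMap, Matrix.cons_val, Matrix.of_apply, ← Complex.normSq_eq_norm_sq,
    Complex.normSq_apply, Complex.add_re, Complex.add_im, Complex.sub_re, Complex.sub_im,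
    Complex.mul_re, Complex.mul_im, Complex.I_re, Complex.I_im, Complex.ofReal_re,
    Complex.ofReal_im]
  ring

theorem zMap_diag (C S : ℂ) (b : Matrix (Fin 2) (Fin 2) ℂ) (i : Fin 2) :
    zMap ![1, C, S] b i i = b i i := by
  fin_cases i <;> simp [zMap]

/-- The averaged encoding channel shrinks the squared norm of the traceless part by `c`. -/
theorem encMap_bound {c : ℝ} (hc1 : c ≤ 1) (C S : Fin 3 → ℝ)
    (h : ∀ k, C k ^ 2 + S k ^ 2 ≤ c) (b : Matrix (Fin 2) (Fin 2) ℂ) :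
    ∑ i, ∑ j, ‖encMap (fun k => ![1, (C k : ℂ), (S k : ℂ)]) b i j‖ ^ 2 ≤
      ‖b 0 0 + b 1 1‖ ^ 2 / 2 + c * (‖b 0 1‖ ^ 2 + ‖b 1 0‖ ^ 2 + ‖b 0 0 - b 1 1‖ ^ 2 / 2) := by
  have hc0 : 0 ≤ c := le_trans (by positivity) (h 0)
  rw [sum_norm_sq_fin_two, norm_sq_add_norm_sq (b 0 1)]
  simp only [encMap]
  rw [zMap_norm_sq, zMap_diag, zMap_diag]
  set b1 := zMap ![1, (C 0 : ℂ), (S 0 : ℂ)] b with hb1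
  have hxy := zMap_norm_sq (C 0) (S 0) b
  rw [← hb1] at hxy
  have d0 : b1 0 0 = b 0 0 := zMap_diag _ _ _ _
  have d1 : b1 1 1 = b 1 1 := zMap_diag _ _ _ _
  set b2 := yMap ![1, (C 1 : ℂ), (S 1 : ℂ)] b1 with hb2
  have t2 : b2 0 0 + b2 1 1 = b 0 0 + b 1 1 := by
    rw [← d0, ← d1]; simp [hb2, yMap]; ring
  have y2 : b2 0 1 - b2 1 0 = b1 0 1 - b1 1 0 := by
    simp [hb2, yMap]; ring
  have x2 : b2 0 1 + b2 1 0 = C 1 * (b1 0 1 + b1 1 0) + S 1 * (b 0 0 - b 1 1) := by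
    rw [← d0, ← d1]; simp [hb2, yMap]; ring
  have z2 : b2 0 0 - b2 1 1 = C 1 * (b 0 0 - b 1 1) - S 1 * (b1 0 1 + b1 1 0) := by
    rw [← d0, ← d1]; simp [hb2, yMap]; ring
  have hxz := norm_sq_rotate (C 1) (S 1) (b1 0 1 + b1 1 0) (b 0 0 - b 1 1)
  rw [← x2, ← z2] at hxz
  rw [t2, y2]
  have k0 := mul_le_mul_of_nonneg_right ((h 0).trans hc1)
    (by positivity : 0 ≤ ‖b 0 1 + b 1 0‖ ^ 2 + ‖b 0 1 - b 1 0‖ ^ 2)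
  rw [← hxy] at k0
  have k1 := mul_le_mul_of_nonneg_right (h 1)
    (by positivity : 0 ≤ ‖b1 0 1 + b1 1 0‖ ^ 2 + ‖b 0 0 - b 1 1‖ ^ 2)
  rw [← hxz] at k1
  have k2 := mul_le_mul_of_nonneg_right ((h 2).trans hc1)
    (by positivity : 0 ≤ ‖b2 0 1 + b2 1 0‖ ^ 2)
  have k3 := mul_le_mul_of_nonneg_right (h 2) (by positivity : 0 ≤ ‖b1 0 1 - b1 1 0‖ ^ 2)
  have k4 := mul_le_mul_of_nonneg_left k0 hc0
  linarith

/-- The entrywise mean over `ν` of the conjugation of `A` by a random matrix `W`. -/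
def avgConj {n Ω : Type*} [Fintype n] [MeasurableSpace Ω] (ν : Measure Ω)
    (W : Ω → Matrix n n ℂ) (A : Matrix n n ℂ) : Matrix n n ℂ :=
  Matrix.of fun i j => ∫ ω, (W ω * A * (W ω)ᴴ) i j ∂ν

theorem conj_apply {n : Type*} [Fintype n] (W A : Matrix n n ℂ) (i j : n) :
    (W * A * Wᴴ) i j = ∑ k, ∑ l, W i k * star (W j l) * A k l := by
  simp only [Matrix.mul_apply, Matrix.conjTranspose_apply, Finset.sum_mul]
  rw [Finset.sum_comm]
  exact Finset.sum_congr rfl fun k _ => Finset.sum_congr rfl fun l _ => by ring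

theorem frobSq_eq_trace {n : Type*} [Fintype n] (A : Matrix n n ℂ) :
    (frobSq A : ℂ) = (A * Aᴴ).trace := by
  simp only [frobSq, Matrix.trace, Matrix.diag, Matrix.mul_apply, Matrix.conjTranspose_apply,
    Complex.ofReal_sum, Complex.ofReal_pow]
  exact Finset.sum_congr rfl fun i _ => Finset.sum_congr rfl fun j _ => (Complex.mul_conj' _).symm

theorem trace_unitary_conj {n : Type*} [Fintype n] [DecidableEq n] {U : Matrix n n ℂ}
    (hU : U ∈ Matrix.unitaryGroup n ℂ) (A : Matrix n n ℂ) : (U * A * Uᴴ).trace = A.trace := by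
  have h : Uᴴ * U = 1 := Matrix.mem_unitaryGroup_iff'.1 hU
  rw [Matrix.trace_mul_comm, ← Matrix.mul_assoc, h, Matrix.one_mul]

theorem frobSq_unitary_conj {n : Type*} [Fintype n] [DecidableEq n] {U : Matrix n n ℂ}
    (hU : U ∈ Matrix.unitaryGroup n ℂ) (A : Matrix n n ℂ) : frobSq (U * A * Uᴴ) = frobSq A := by
  have h : Uᴴ * U = 1 := Matrix.mem_unitaryGroup_iff'.1 hU
  apply Complex.ofReal_injective
  rw [frobSq_eq_trace, frobSq_eq_trace, ← trace_unitary_conj hU (A * Aᴴ)]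
  congr 1
  simp only [Matrix.conjTranspose_mul, Matrix.conjTranspose_conjTranspose, Matrix.mul_assoc]
  rw [← Matrix.mul_assoc Uᴴ U, h, Matrix.one_mul]

/-- The circuit `W_{L-1}(x_{L-1}) ⋯ W_0(x_0)`. -/
def circuit {n Ω : Type*} [Fintype n] [DecidableEq n] {L : ℕ} (W : Fin L → Ω → Matrix n n ℂ)
    (x : Fin L → Ω) : Matrix n n ℂ :=
  (List.ofFn fun l => W l (x l)).reverse.prod

theorem circuit_succ {n Ω : Type*} [Fintype n] [DecidableEq n] {L : ℕ}
    (W : Fin (L + 1) → Ω → Matrix n n ℂ) (x : Fin (L + 1) → Ω) :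
    circuit W x = circuit (fun l => W l.succ) (fun l => x l.succ) * W 0 (x 0) := by
  simp [circuit, List.ofFn_succ]

theorem circuit_mem_unitaryGroup {n Ω : Type*} [Fintype n] [DecidableEq n] {L : ℕ}
    {W : Fin L → Ω → Matrix n n ℂ}
    (hW : ∀ l ω, W l ω ∈ Matrix.unitaryGroup n ℂ) (x : Fin L → Ω) :
    circuit W x ∈ Matrix.unitaryGroup n ℂ := by
  refine list_prod_mem fun A hA => ?_
  simp only [List.mem_reverse, List.mem_ofFn] at hA
  obtain ⟨l, rfl⟩ := hA
  exact hW l _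

section Averages

variable {n Ω Ω' : Type*} [Fintype n] [DecidableEq n] [MeasurableSpace Ω] [MeasurableSpace Ω']

theorem integrable_entry_mul {ν : Measure Ω} [IsFiniteMeasure ν] {W : Ω → Matrix n n ℂ}
    (hW : ∀ ω, W ω ∈ Matrix.unitaryGroup n ℂ) (hm : ∀ i j, Measurable fun ω => W ω i j)
    (i j k l : n) : Integrable (fun ω => W ω i k * star (W ω j l)) ν := by
  refine .of_bound ((hm i k).mul (continuous_star.measurable.comp (hm j l))).aestronglyMeasurable
    1 (.of_forall fun ω => ?_)
  rw [norm_mul, norm_star]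
  exact mul_le_one₀ (entry_norm_bound_of_unitary (hW ω) _ _) (norm_nonneg _)
    (entry_norm_bound_of_unitary (hW ω) _ _)

theorem integrable_conj {ν : Measure Ω} [IsFiniteMeasure ν] {W : Ω → Matrix n n ℂ}
    (hW : ∀ ω, W ω ∈ Matrix.unitaryGroup n ℂ) (hm : ∀ i j, Measurable fun ω => W ω i j)
    (A : Matrix n n ℂ) (i j : n) : Integrable (fun ω => (W ω * A * (W ω)ᴴ) i j) ν := by
  simp_rw [conj_apply]
  exact integrable_finsetSum _ fun k _ => integrable_finsetSum _ fun l _ =>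
    (integrable_entry_mul hW hm i j k l).mul_const _

theorem avgConj_apply {ν : Measure Ω} [IsFiniteMeasure ν] {W : Ω → Matrix n n ℂ}
    (hW : ∀ ω, W ω ∈ Matrix.unitaryGroup n ℂ) (hm : ∀ i j, Measurable fun ω => W ω i j)
    (A : Matrix n n ℂ) (i j : n) :
    avgConj ν W A i j = ∑ k, ∑ l, (∫ ω, W ω i k * star (W ω j l) ∂ν) * A k l := by
  simp only [avgConj, Matrix.of_apply, conj_apply]
  rw [integral_finsetSum _ fun k _ => integrable_finsetSum _ fun l _ =>
    (integrable_entry_mul hW hm i j k l).mul_const (A k l)]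
  refine Finset.sum_congr rfl fun k _ => ?_
  rw [integral_finsetSum _ fun l _ => (integrable_entry_mul hW hm i j k l).mul_const (A k l)]
  simp_rw [integral_mul_const]

theorem trace_avgConj {ν : Measure Ω} [IsProbabilityMeasure ν] {W : Ω → Matrix n n ℂ}
    (hW : ∀ ω, W ω ∈ Matrix.unitaryGroup n ℂ) (hm : ∀ i j, Measurable fun ω => W ω i j)
    (A : Matrix n n ℂ) : (avgConj ν W A).trace = A.trace := by
  simp only [Matrix.trace, avgConj, Matrix.diag, Matrix.of_apply]
  rw [← integral_finsetSum _ fun i _ => integrable_conj hW hm A i i]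
  have h : ∀ ω, ∑ i, (W ω * A * (W ω)ᴴ) i i = A.trace := fun ω => trace_unitary_conj (hW ω) A
  simp [h, Matrix.trace]

theorem avgConj_prod {ν : Measure Ω} {ν' : Measure Ω'} [IsProbabilityMeasure ν]
    [IsProbabilityMeasure ν'] {W : Ω → Matrix n n ℂ} {V : Ω' → Matrix n n ℂ}
    (hW : ∀ ω, W ω ∈ Matrix.unitaryGroup n ℂ) (hWm : ∀ i j, Measurable fun ω => W ω i j)
    (hV : ∀ ω, V ω ∈ Matrix.unitaryGroup n ℂ) (hVm : ∀ i j, Measurable fun ω => V ω i j)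
    (A : Matrix n n ℂ) :
    avgConj (ν.prod ν') (fun z => V z.2 * W z.1) A = avgConj ν' V (avgConj ν W A) := by
  ext i j
  have e : ∀ z : Ω × Ω', (V z.2 * W z.1 * A * (V z.2 * W z.1)ᴴ) i j =
      ∑ k, ∑ l, (W z.1 * A * (W z.1)ᴴ) k l * (V z.2 i k * star (V z.2 j l)) := fun z => by
    rw [Matrix.conjTranspose_mul, show V z.2 * W z.1 * A * ((W z.1)ᴴ * (V z.2)ᴴ) =
      V z.2 * (W z.1 * A * (W z.1)ᴴ) * (V z.2)ᴴ by simp only [Matrix.mul_assoc], conj_apply]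
    exact Finset.sum_congr rfl fun k _ => Finset.sum_congr rfl fun l _ => mul_comm _ _
  have hi (k l) : Integrable (fun z : Ω × Ω' =>
      (W z.1 * A * (W z.1)ᴴ) k l * (V z.2 i k * star (V z.2 j l))) (ν.prod ν') :=
    (integrable_conj hW hWm A k l).mul_prod (integrable_entry_mul hV hVm i j k l)
  rw [avgConj_apply hV hVm]
  simp only [avgConj, Matrix.of_apply]
  simp_rw [e]
  rw [integral_finsetSum _ fun k _ => integrable_finsetSum _ fun l _ => hi k l]
  refine Finset.sum_congr rfl fun k _ => ?_
  rw [integral_finsetSum _ fun l _ => hi k l]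
  refine Finset.sum_congr rfl fun l _ => ?_
  rw [integral_prod_mul (fun ω => (W ω * A * (W ω)ᴴ) k l) fun ω => V ω i k * star (V ω j l),
    mul_comm]

theorem avgConj_unitary_mul {ν : Measure Ω} [IsProbabilityMeasure ν] {W : Ω → Matrix n n ℂ}
    (hW : ∀ ω, W ω ∈ Matrix.unitaryGroup n ℂ) (hm : ∀ i j, Measurable fun ω => W ω i j)
    (U A : Matrix n n ℂ) :
    avgConj ν (fun ω => U * W ω) A = U * avgConj ν W A * Uᴴ := by
  ext i j
  have e : ∀ ω, (U * W ω * A * (U * W ω)ᴴ) i j =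
      ∑ k, ∑ l, U i k * star (U j l) * (W ω * A * (W ω)ᴴ) k l := fun ω => by
    rw [← conj_apply, Matrix.conjTranspose_mul]
    simp only [Matrix.mul_assoc]
  rw [conj_apply]
  simp only [avgConj, Matrix.of_apply]
  simp_rw [e]
  rw [integral_finsetSum _ fun k _ => integrable_finsetSum _ fun l _ =>
    (integrable_conj hW hm A k l).const_mul _]
  refine Finset.sum_congr rfl fun k _ => ?_
  rw [integral_finsetSum _ fun l _ => (integrable_conj hW hm A k l).const_mul _]
  simp_rw [integral_const_mul]

theorem measurable_circuit {L : ℕ} {W : Fin L → Ω → Matrix n n ℂ}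
    (hm : ∀ l i j, Measurable fun ω => W l ω i j) (i j : n) :
    Measurable fun x => circuit W x i j := by
  induction L generalizing i j with
  | zero => simp [circuit]
  | succ L ih =>
    simp_rw [circuit_succ, Matrix.mul_apply]
    refine Finset.measurable_sum _ fun k _ => Measurable.mul ?_ ?_
    · exact (ih (fun l => hm l.succ) i k).comp (by fun_prop : Measurable
        fun (x : Fin (L + 1) → Ω) (l : Fin L) => x l.succ)
    · exact (hm 0 k j).comp (measurable_pi_apply 0)

theorem avgConj_circuit_succ {L : ℕ} {W : Fin (L + 1) → Ω → Matrix n n ℂ}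
    {ν : Fin (L + 1) → Measure Ω} [∀ l, IsProbabilityMeasure (ν l)]
    (hW : ∀ l ω, W l ω ∈ Matrix.unitaryGroup n ℂ)
    (hm : ∀ l i j, Measurable fun ω => W l ω i j) (A : Matrix n n ℂ) :
    avgConj (Measure.pi ν) (circuit W) A =
      avgConj (Measure.pi fun l : Fin L => ν l.succ) (circuit fun l => W l.succ)
        (avgConj (ν 0) (W 0) A) := by
  rw [← avgConj_prod (hW 0) (hm 0) (circuit_mem_unitaryGroup fun l => hW l.succ)
    (measurable_circuit fun l => hm l.succ)]
  ext i j
  have h := (measurePreserving_piFinSuccAbove ν 0).integral_comp'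
    (fun z : Ω × (Fin L → Ω) => ((circuit (fun l => W l.succ) z.2 * W 0 z.1) * A *
      (circuit (fun l => W l.succ) z.2 * W 0 z.1)ᴴ) i j)
  simp only [avgConj, Matrix.of_apply, circuit_succ W]
  exact h

/-- If every layer of a random circuit shrinks on average the squared norm of the traceless part
by `c`, then the whole circuit shrinks it on average by `c ^ L`. -/
theorem frobSq_avgConj_circuit_le {c d : ℝ} (hc : 0 ≤ c) {L : ℕ} {W : Fin L → Ω → Matrix n n ℂ}
    {ν : Fin L → Measure Ω} [∀ l, IsProbabilityMeasure (ν l)]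
    (hW : ∀ l ω, W l ω ∈ Matrix.unitaryGroup n ℂ)
    (hm : ∀ l i j, Measurable fun ω => W l ω i j)
    (hlayer : ∀ l A, d * frobSq (avgConj (ν l) (W l) A) ≤
      (1 - c) * ‖A.trace‖ ^ 2 + c * (d * frobSq A)) (A : Matrix n n ℂ) :
    d * frobSq (avgConj (Measure.pi ν) (circuit W) A) ≤
      ‖A.trace‖ ^ 2 + c ^ L * (d * frobSq A - ‖A.trace‖ ^ 2) := by
  induction L generalizing A with
  | zero =>
    have h : avgConj (Measure.pi ν) (circuit W) A = A := by
      ext i j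
      simp [avgConj, circuit]
    rw [h]
    simp
  | succ L ih =>
    rw [avgConj_circuit_succ hW hm]
    refine (ih (fun l => hW l.succ) (fun l => hm l.succ) (fun l => hlayer l.succ) _).trans ?_
    rw [trace_avgConj (hW 0) (hm 0), pow_succ c, mul_assoc]
    gcongr
    linarith [hlayer 0 A]

end Averages

theorem integral_pi_curry {ι κ X : Type*} [Fintype ι] [Fintype κ] [MeasurableSpace X]
    (μ : ι → κ → Measure X) [∀ i j, IsProbabilityMeasure (μ i j)] (F : (ι → κ → X) → ℂ) :
    ∫ x, F (fun i j => x (i, j)) ∂Measure.pi (fun p : ι × κ => μ p.1 p.2) =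
      ∫ y, F y ∂Measure.pi fun i => Measure.pi (μ i) := by
  simp_rw [← Measure.infinitePi_eq_pi]
  rw [← Measure.infinitePi_map_curry, integral_map_equiv]
  rfl

theorem kron_mul {N : ℕ} (A B : Fin N → Matrix (Fin 2) (Fin 2) ℂ) :
    kron A * kron B = kron fun n => A n * B n := by
  ext i j
  simp only [kron, Matrix.mul_apply, Matrix.of_apply, ← Finset.prod_mul_distrib]
  rw [Finset.prod_univ_sum, Fintype.piFinset_univ]

theorem kron_conjTranspose {N : ℕ} (A : Fin N → Matrix (Fin 2) (Fin 2) ℂ) :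
    (kron A)ᴴ = kron fun n => (A n)ᴴ := by
  ext i j
  simp [kron, Matrix.conjTranspose_apply]

theorem kron_one {N : ℕ} : (kron fun _ : Fin N => 1) = 1 := by
  ext i j
  simp only [kron, Matrix.of_apply, Matrix.one_apply, Finset.prod_ite_zero, Finset.prod_const_one,
    Finset.mem_univ, true_implies, funext_iff]

theorem trace_kron {N : ℕ} (A : Fin N → Matrix (Fin 2) (Fin 2) ℂ) :
    (kron A).trace = ∏ n, (A n).trace := by
  simp only [kron, Matrix.trace, Matrix.diag, Matrix.of_apply]
  rw [Finset.prod_univ_sum, Fintype.piFinset_univ]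

theorem trace_rho0 (N : ℕ) : (rho0 N).trace = 1 := by
  simp [rho0, trace_kron, ket0, Matrix.trace_fin_two]

theorem frobSq_rho0 (N : ℕ) : frobSq (rho0 N) = 1 := by
  have h : ket0 * ket0ᴴ = ket0 := by
    ext i j
    fin_cases i <;> fin_cases j <;> simp [ket0, Matrix.mul_apply]
  apply Complex.ofReal_injective
  rw [frobSq_eq_trace, rho0, kron_conjTranspose, kron_mul, h]
  simpa [rho0] using trace_rho0 N

theorem encGate_mul_conjTranspose (x : Fin 3 → ℝ) : encGate x * (encGate x)ᴴ = 1 := by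
  have hz : ∀ φ, zMap (trigVec φ) 1 = 1 := fun φ => by
    ext i j
    fin_cases i <;> fin_cases j <;> simp [zMap, trigVec]
  have hy : ∀ φ, yMap (trigVec φ) 1 = 1 := fun φ => by
    ext i j
    fin_cases i <;> fin_cases j <;> norm_num [yMap, trigVec]
  have h := encGate_conj x 1
  rwa [Matrix.mul_one, encMap, hz, hy, hz] at h

theorem layerGate_mem_unitaryGroup {N : ℕ} (x : Fin N → Fin 3 → ℝ) :
    layerGate x ∈ Matrix.unitaryGroup (Fin N → Fin 2) ℂ := by
  rw [Matrix.mem_unitaryGroup_iff]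
  change layerGate x * (layerGate x)ᴴ = 1
  simp only [layerGate, kron_conjTranspose, kron_mul, encGate_mul_conjTranspose, kron_one]

theorem continuous_rotG (P : Matrix (Fin 2) (Fin 2) ℂ) : Continuous (rotG P) := by
  unfold rotG
  fun_prop

theorem continuous_encGate : Continuous encGate := by
  unfold encGate Rz Ry
  exact (((continuous_rotG _).comp (continuous_apply 2)).mul
    ((continuous_rotG _).comp (continuous_apply 1))).mul
      ((continuous_rotG _).comp (continuous_apply 0))

theorem continuous_layerGate {N : ℕ} (i j : Fin N → Fin 2) :
    Continuous fun x : Fin N → Fin 3 → ℝ => layerGate x i j := by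
  simp only [layerGate, kron, Matrix.of_apply]
  exact continuous_finsetProd _ fun n _ =>
    (continuous_encGate.comp (continuous_apply n)).matrix_elem _ _

/-- The coefficients of the averaged single-qubit encoding channel. -/
def encCoeff (μ : Fin 3 → ℝ) (v : Fin 3 → ℝ≥0) (i j k l : Fin 2) : ℂ :=
  encMap (fun a => meanVec (μ a) (v a)) (Matrix.single k l 1) i j

theorem integral_encGate (μ : Fin 3 → ℝ) (v : Fin 3 → ℝ≥0) (i j k l : Fin 2) :
    ∫ x, encGate x i k * star (encGate x j l) ∂Measure.pi (fun a => gaussianReal (μ a) (v a)) =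
      encCoeff μ v i j k l := by
  rw [encCoeff, ← integral_encMap]
  congr with x
  rw [← encGate_conj, conj_apply]
  simp [Matrix.single_apply, ite_and]

theorem sum_encCoeff (μ : Fin 3 → ℝ) (v : Fin 3 → ℝ≥0) (b : Matrix (Fin 2) (Fin 2) ℂ)
    (i j : Fin 2) :
    ∑ k, ∑ l, encCoeff μ v i j k l * b k l = encMap (fun a => meanVec (μ a) (v a)) b i j := by
  simp only [encCoeff]
  generalize (fun a => meanVec (μ a) (v a)) = w
  fin_cases i <;> fin_cases j <;>
  · simp [encMap, zMap, yMap, Fin.sum_univ_two, Matrix.single_apply]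
    ring

theorem avgConj_layerGate {N : ℕ} (μ : Fin N → Fin 3 → ℝ) (v : Fin N → Fin 3 → ℝ≥0)
    (A : Matrix (Fin N → Fin 2) (Fin N → Fin 2) ℂ) :
    avgConj (Measure.pi fun n => Measure.pi fun a => gaussianReal (μ n a) (v n a)) layerGate A =
      tensorMap (fun n => encCoeff (μ n) (v n)) A := by
  ext i j
  rw [avgConj_apply layerGate_mem_unitaryGroup fun i j => (continuous_layerGate i j).measurable]
  simp only [tensorMap, Matrix.of_apply, layerGate, kron, star_prod, ← Finset.prod_mul_distrib]
  refine Finset.sum_congr rfl fun k _ => Finset.sum_congr rfl fun l _ => ?_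
  rw [integral_fintype_prod_eq_prod
    (fun n x => encGate x (i n) (k n) * star (encGate x (j n) (l n)))]
  simp_rw [integral_encGate]

/-- An encoding layer shrinks on average the squared norm of the traceless part by `exp (-σ²)`. -/
theorem frobSq_avgConj_layerGate_le {N : ℕ} {μ : Fin N → Fin 3 → ℝ} {v : Fin N → Fin 3 → ℝ≥0}
    {σ2 : ℝ} (hσ2 : 0 ≤ σ2) (hv : ∀ n i, σ2 ≤ v n i)
    (A : Matrix (Fin N → Fin 2) (Fin N → Fin 2) ℂ) :
    2 ^ N * frobSq (avgConj
      (Measure.pi fun n => Measure.pi fun a => gaussianReal (μ n a) (v n a)) layerGate A) ≤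
      (1 - Real.exp (-σ2)) * ‖A.trace‖ ^ 2 + Real.exp (-σ2) * (2 ^ N * frobSq A) := by
  rw [avgConj_layerGate]
  have hc1 : Real.exp (-σ2) ≤ 1 := Real.exp_le_one_iff.2 (by linarith)
  refine frobSq_tensorMap_le (Real.exp_pos _).le hc1 _ (fun n b => ?_) A
  simp_rw [sum_encCoeff]
  refine encMap_bound hc1 (fun a => Real.exp (-v n a / 2) * Real.cos (μ n a))
    (fun a => Real.exp (-v n a / 2) * Real.sin (μ n a)) (fun a => ?_) b
  rw [meanVec_norm_sq]
  exact Real.exp_le_exp.2 (neg_le_neg (hv n a))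

theorem abs_re_trace_sq_le {n : Type*} [Fintype n] (A : Matrix n n ℂ) :
    |((A * A).trace).re| ≤ frobSq A := by
  have h : ‖(A * A).trace‖ ≤ ∑ i, ∑ j, (‖A i j‖ ^ 2 + ‖A j i‖ ^ 2) / 2 := by
    simp only [Matrix.trace, Matrix.diag, Matrix.mul_apply]
    refine norm_sum_le_of_le _ fun i _ => norm_sum_le_of_le _ fun j _ => ?_
    rw [norm_mul]
    linarith [two_mul_le_add_sq ‖A i j‖ ‖A j i‖]
  refine (Complex.abs_re_le_norm _).trans (h.trans_eq ?_)
  simp only [← Finset.sum_div, Finset.sum_add_distrib]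
  rw [Finset.sum_comm (f := fun i j => ‖A j i‖ ^ 2), ← frobSq]
  ring

/-- For an `N`-qubit data re-uploading circuit with `L` encoding layers
(no repetition), arbitrary interleaved unitaries, and independent Gaussian data whose
variances are all at least `σ²`, the Petz–Rényi-2 divergence of the expected encoded state
from the maximally mixed state is at most `log₂(1 + (2^N − 1)·e^{−Lσ²})`; equivalently,
`2^N · Tr[(E[ρ])²] ≤ 1 + (2^N − 1)·e^{−Lσ²}`. -/
theorem statement0
    (N L : ℕ) (hN : 1 ≤ N) (hL : 1 ≤ L)
    (μ : Fin L → Fin N → Fin 3 → ℝ) (v : Fin L → Fin N → Fin 3 → ℝ≥0)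
    (σ2 : ℝ) (hσ2 : 0 < σ2) (hv : ∀ l n i, σ2 ≤ (v l n i : ℝ))
    (U : Fin L → Matrix (Fin N → Fin 2) (Fin N → Fin 2) ℂ)
    (hU : ∀ l, U l ∈ Matrix.unitaryGroup (Fin N → Fin 2) ℂ)
    -- the product Gaussian measure on the data
    (μx : Measure (Fin L × Fin N × Fin 3 → ℝ))
    (hμx : μx = Measure.pi fun p => gaussianReal (μ p.1 p.2.1 p.2.2) (v p.1 p.2.1 p.2.2))
    -- the data re-uploading circuit `V(x) = U_L R_L(x_{[L]}) ⋯ U_1 R_1(x_{[1]})`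
    (V : (Fin L × Fin N × Fin 3 → ℝ) → Matrix (Fin N → Fin 2) (Fin N → Fin 2) ℂ)
    (hV : ∀ x, V x =
      (List.ofFn fun l : Fin L => U l * layerGate fun n i => x (l, n, i)).reverse.prod)
    -- the entrywise expectation of the encoded state `ρ(x) = V(x) ρ₀ V(x)†`
    (Eρ : Matrix (Fin N → Fin 2) (Fin N → Fin 2) ℂ)
    (hE : Eρ = Matrix.of fun i j => ∫ x, (V x * rho0 N * (V x)ᴴ) i j ∂μx) :
    Real.logb 2 ((2 : ℝ) ^ N * ((Eρ * Eρ).trace).re) ≤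
      Real.logb 2 (1 + ((2 : ℝ) ^ N - 1) * Real.exp (-(L : ℝ) * σ2)) ∧
    (2 : ℝ) ^ N * ((Eρ * Eρ).trace).re ≤
      1 + ((2 : ℝ) ^ N - 1) * Real.exp (-(L : ℝ) * σ2) := by
  set d : ℝ := 2 ^ N
  set B : ℝ := 1 + (d - 1) * Real.exp (-(L : ℝ) * σ2)
  have hd : 1 ≤ d := one_le_pow₀ one_le_two
  have hB : 1 ≤ B := le_add_of_nonneg_right (mul_nonneg (by linarith) (Real.exp_pos _).le)
  let ν : Fin L → Measure (Fin N → Fin 3 → ℝ) := fun l =>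
    Measure.pi fun n => Measure.pi fun a => gaussianReal (μ l n a) (v l n a)
  let ν' : Fin L → Measure (Fin N × Fin 3 → ℝ) := fun l =>
    Measure.pi fun p => gaussianReal (μ l p.1 p.2) (v l p.1 p.2)
  let R : (Fin N × Fin 3 → ℝ) → Matrix (Fin N → Fin 2) (Fin N → Fin 2) ℂ := fun y =>
    layerGate fun n i => y (n, i)
  let W : Fin L → (Fin N × Fin 3 → ℝ) → Matrix (Fin N → Fin 2) (Fin N → Fin 2) ℂ := fun l y =>
    U l * R y
  have hR : ∀ y, R y ∈ Matrix.unitaryGroup (Fin N → Fin 2) ℂ := fun y =>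
    layerGate_mem_unitaryGroup _
  have hRm : ∀ i j, Measurable fun y => R y i j := fun i j =>
    (continuous_layerGate i j).measurable.comp (by fun_prop)
  have hW : ∀ l y, W l y ∈ Matrix.unitaryGroup (Fin N → Fin 2) ℂ := fun l y =>
    mul_mem (hU l) (hR y)
  have hWm : ∀ l i j, Measurable fun y => W l y i j := fun l i j => by
    simp only [W, Matrix.mul_apply]
    exact Finset.measurable_sum _ fun k _ => (hRm k j).const_mul _
  have hRavg : ∀ l A, avgConj (ν' l) R A = avgConj (ν l) layerGate A := fun l A => by
    ext i j
    exact integral_pi_curry (fun n a => gaussianReal (μ l n a) (v l n a))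
      fun y => (layerGate y * A * (layerGate y)ᴴ) i j
  have hEavg : Eρ = avgConj (Measure.pi ν') (circuit W) (rho0 N) := by
    ext i j
    rw [hE, hμx]
    simp only [Matrix.of_apply, hV]
    exact integral_pi_curry
      (fun l (p : Fin N × Fin 3) => gaussianReal (μ l p.1 p.2) (v l p.1 p.2))
      fun y => (circuit W y * rho0 N * (circuit W y)ᴴ) i j
  have hfrob : d * frobSq Eρ ≤ B := by
    have h := frobSq_avgConj_circuit_le (d := d) (Real.exp_pos (-σ2)).le (ν := ν') hW hWm
      (fun l A => by
        rw [avgConj_unitary_mul hR hRm, frobSq_unitary_conj (hU l), hRavg]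
        exact frobSq_avgConj_layerGate_le hσ2.le (hv l) A) (rho0 N)
    rw [← hEavg, trace_rho0, frobSq_rho0, ← Real.exp_nat_mul] at h
    refine h.trans_eq ?_
    rw [norm_one, one_pow, mul_one, mul_neg, ← neg_mul, mul_comm (Real.exp _)]
  have habs : |d * ((Eρ * Eρ).trace).re| ≤ B := by
    rw [abs_mul, abs_of_nonneg (by linarith : 0 ≤ d)]
    exact (mul_le_mul_of_nonneg_left (abs_re_trace_sq_le Eρ) (by linarith)).trans hfrob
  refine ⟨?_, (le_abs_self _).trans habs⟩
  rw [← Real.logb_abs]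
  rcases (abs_nonneg (d * ((Eρ * Eρ).trace).re)).eq_or_lt with h0 | h0
  · rw [← h0, Real.logb_zero]
    exact Real.logb_nonneg one_lt_two hB
  · exact Real.logb_le_logb_of_le one_lt_two h0 habs
end
end

section
/- Let x be a real Gaussian random variable with mean μ and variance σ², and let R_z(x) = exp(−i·x·Z/2), R_y(x) = exp(−i·x·Y/2). Then the following entrywise matrix expectations hold: E[R_z(x) X R_z(x)†] = e^{−σ²/2}(cos(μ)·X + sin(μ)·Y); E[R_z(x) Y R_z(x)†] = e^{−σ²/2}(−sin(μ)·X + cos(μ)·Y); E[R_z(x) Z R_z(x)†] = Z; E[R_y(x) Z R_y(x)†] = e^{−σ²/2}(cos(μ)·Z + sin(μ)·X); E[R_y(x) X R_y(x)†] = e^{−σ²/2}(−sin(μ)·Z + cos(μ)·X); E[R_y(x) Y R_y(x)†] = Y. Equivalently, in the ordered Pauli basis (I, Z, X, Y), the expected transfer matrices of R_z and R_y are diag(1,1) ⊕ e^{−σ²/2}·Rot(μ) blocks as given in the paper. -/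
open Matrix MeasureTheory ProbabilityTheory
open scoped NNReal ENNReal ComplexOrder

noncomputable section

theorem integrable_cos_gaussianReal (μ : ℝ) (v : ℝ≥0) :
    Integrable (fun x => Real.cos x) (gaussianReal μ v) :=
  .of_bound (by fun_prop) 1 (.of_forall fun x => Real.abs_cos_le_one x)

theorem integrable_sin_gaussianReal (μ : ℝ) (v : ℝ≥0) :
    Integrable (fun x => Real.sin x) (gaussianReal μ v) :=
  .of_bound (by fun_prop) 1 (.of_forall fun x => Real.abs_sin_le_one x)

theorem integral_cexp_mul_I_gaussianReal (μ : ℝ) (v : ℝ≥0) :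
    ∫ x : ℝ, Complex.exp (x * Complex.I) ∂(gaussianReal μ v)
      = Complex.exp (((-(v : ℝ) / 2 : ℝ) : ℂ) + (μ : ℂ) * Complex.I) := by
  have h := charFun_gaussianReal (μ := μ) (v := v) 1
  rw [charFun_apply_real] at h
  simp only [Complex.ofReal_one, one_mul] at h
  rw [h]
  congr 1
  push_cast
  ring

theorem integrable_cexp_mul_I_gaussianReal (μ : ℝ) (v : ℝ≥0) :
    Integrable (fun x : ℝ => Complex.exp (x * Complex.I)) (gaussianReal μ v) :=
  .of_bound (by fun_prop) 1 (.of_forall fun x => (Complex.norm_exp_ofReal_mul_I x).le)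

theorem integral_cos_gaussianReal (μ : ℝ) (v : ℝ≥0) :
    ∫ x, Real.cos x ∂(gaussianReal μ v) = Real.exp (-(v : ℝ) / 2) * Real.cos μ := by
  have h := integral_re (integrable_cexp_mul_I_gaussianReal μ v)
  rw [integral_cexp_mul_I_gaussianReal] at h
  simpa [Complex.exp_ofReal_mul_I_re, Complex.exp_re] using h

theorem integral_sin_gaussianReal (μ : ℝ) (v : ℝ≥0) :
    ∫ x, Real.sin x ∂(gaussianReal μ v) = Real.exp (-(v : ℝ) / 2) * Real.sin μ := by
  have h := integral_im (integrable_cexp_mul_I_gaussianReal μ v)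
  rw [integral_cexp_mul_I_gaussianReal] at h
  simpa [Complex.exp_ofReal_mul_I_im, Complex.exp_im] using h

/-- Entrywise Gaussian expectation of a rotation by the angle `x` in the plane of `A` and `B`. -/
theorem integral_cos_smul_add_sin_smul_gaussianReal {m n : Type*} (μ : ℝ) (v : ℝ≥0)
    (A B : Matrix m n ℂ) :
    (Matrix.of fun i j =>
        ∫ x : ℝ, ((Real.cos x : ℂ) • A + (Real.sin x : ℂ) • B) i j ∂(gaussianReal μ v))
      = (Real.exp (-(v : ℝ) / 2) : ℂ) • ((Real.cos μ : ℂ) • A + (Real.sin μ : ℂ) • B) := by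
  ext i j
  simp only [Matrix.of_apply, Matrix.add_apply, Matrix.smul_apply, smul_eq_mul]
  rw [integral_add ((integrable_cos_gaussianReal μ v).ofReal.mul_const _)
      ((integrable_sin_gaussianReal μ v).ofReal.mul_const _), integral_mul_const,
    integral_mul_const, integral_complex_ofReal, integral_complex_ofReal,
    integral_cos_gaussianReal, integral_sin_gaussianReal]
  push_cast
  ring

/-- A rotation gate generated by a Hermitian involution `P` rotates every `Q` anticommuting
with `P` by the full angle. -/
theorem rotG_conj_of_anticommute {P Q : Matrix (Fin 2) (Fin 2) ℂ} (hP : P.IsHermitian)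
    (hPP : P * P = 1) (hPQ : Q * P = -(P * Q)) (x : ℝ) :
    rotG P x * Q * (rotG P x)ᴴ
      = (Real.cos x : ℂ) • Q + (Real.sin x : ℂ) • (-Complex.I • (P * Q)) := by
  have hPQP : P * Q * P = -Q := by rw [mul_assoc, hPQ, mul_neg, ← mul_assoc, hPP, one_mul]
  have hx : x = 2 * (x / 2) := by ring
  have hc : (Real.cos x : ℂ) = (Real.cos (x / 2) : ℂ) ^ 2 - (Real.sin (x / 2) : ℂ) ^ 2 := by
    exact_mod_cast (congrArg Real.cos hx).trans (Real.cos_two_mul' (x / 2))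
  have hs : (Real.sin x : ℂ) = 2 * Real.sin (x / 2) * Real.cos (x / 2) := by
    exact_mod_cast (congrArg Real.sin hx).trans (Real.sin_two_mul (x / 2))
  rw [hc, hs]
  simp only [rotG, conjTranspose_sub, conjTranspose_smul, conjTranspose_one, hP.eq, star_mul',
    Complex.star_def, Complex.conj_I, Complex.conj_ofReal, sub_mul, mul_sub, smul_mul_assoc,
    mul_smul_comm, one_mul, mul_one, hPQ, hPQP]
  match_scalars
  · linear_combination Complex.sin (x / 2) ^ 2 * Complex.I_sq
  · ring

/-- A rotation gate generated by a Hermitian involution `P` fixes every `Q` commuting with `P`. -/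
theorem rotG_conj_of_commute {P Q : Matrix (Fin 2) (Fin 2) ℂ} (hP : P.IsHermitian)
    (hPP : P * P = 1) (hPQ : Q * P = P * Q) (x : ℝ) :
    rotG P x * Q * (rotG P x)ᴴ = Q := by
  have hPQP : P * Q * P = Q := by rw [mul_assoc, hPQ, ← mul_assoc, hPP, one_mul]
  have h : (Real.cos (x / 2) : ℂ) ^ 2 + (Real.sin (x / 2) : ℂ) ^ 2 = 1 := by
    exact_mod_cast Real.cos_sq_add_sin_sq (x / 2)
  simp only [rotG, conjTranspose_sub, conjTranspose_smul, conjTranspose_one, hP.eq, star_mul',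
    Complex.star_def, Complex.conj_I, Complex.conj_ofReal, sub_mul, mul_sub, smul_mul_assoc,
    mul_smul_comm, one_mul, mul_one, hPQ, hPQP]
  match_scalars
  · push_cast at h ⊢
    linear_combination h - Complex.sin (x / 2) ^ 2 * Complex.I_sq
  · ring

theorem PZ_isHermitian : PZ.IsHermitian := by
  ext i j; fin_cases i <;> fin_cases j <;> simp [PZ]

theorem PY_isHermitian : PY.IsHermitian := by
  ext i j; fin_cases i <;> fin_cases j <;> simp [PY]

theorem PZ_mul_self : PZ * PZ = 1 := by
  simp [PZ, Matrix.one_fin_two]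

theorem PY_mul_self : PY * PY = 1 := by
  simp [PY, Matrix.one_fin_two]

/-- For `x ~ N(μ, σ²)`, the entrywise Gaussian expectations of the
Pauli matrices conjugated by `R_z(x)` and `R_y(x)` are:
`E[R_z X R_z†] = e^{−σ²/2}(cos μ·X + sin μ·Y)`, `E[R_z Y R_z†] = e^{−σ²/2}(−sin μ·X + cos μ·Y)`,
`E[R_z Z R_z†] = Z`, `E[R_y Z R_y†] = e^{−σ²/2}(cos μ·Z + sin μ·X)`,
`E[R_y X R_y†] = e^{−σ²/2}(−sin μ·Z + cos μ·X)`, `E[R_y Y R_y†] = Y`. -/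
theorem statement8
    (μ : ℝ) (v : ℝ≥0)
    -- the entrywise expectation of a matrix-valued function over `gaussianReal μ v`
    (EG : (ℝ → Matrix (Fin 2) (Fin 2) ℂ) → Matrix (Fin 2) (Fin 2) ℂ)
    (hEG : ∀ f, EG f = Matrix.of fun i j => ∫ x, f x i j ∂(gaussianReal μ v)) :
    EG (fun x => Rz x * PX * (Rz x)ᴴ)
      = (Real.exp (-(v : ℝ) / 2) : ℂ) •
          ((Real.cos μ : ℂ) • PX + (Real.sin μ : ℂ) • PY) ∧
    EG (fun x => Rz x * PY * (Rz x)ᴴ)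
      = (Real.exp (-(v : ℝ) / 2) : ℂ) •
          (-((Real.sin μ : ℂ) • PX) + (Real.cos μ : ℂ) • PY) ∧
    EG (fun x => Rz x * PZ * (Rz x)ᴴ) = PZ ∧
    EG (fun x => Ry x * PZ * (Ry x)ᴴ)
      = (Real.exp (-(v : ℝ) / 2) : ℂ) •
          ((Real.cos μ : ℂ) • PZ + (Real.sin μ : ℂ) • PX) ∧
    EG (fun x => Ry x * PX * (Ry x)ᴴ)
      = (Real.exp (-(v : ℝ) / 2) : ℂ) •
          (-((Real.sin μ : ℂ) • PZ) + (Real.cos μ : ℂ) • PX) ∧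
    EG (fun x => Ry x * PY * (Ry x)ᴴ) = PY := by
  have integral_conj {P Q B : Matrix (Fin 2) (Fin 2) ℂ} (hP : P.IsHermitian)
      (hPP : P * P = 1) (hPQ : Q * P = -(P * Q)) (hB : -Complex.I • (P * Q) = B) :
      EG (fun x => rotG P x * Q * (rotG P x)ᴴ)
        = (Real.exp (-(v : ℝ) / 2) : ℂ) • ((Real.cos μ : ℂ) • Q + (Real.sin μ : ℂ) • B) := by
    rw [hEG]
    simp only [rotG_conj_of_anticommute hP hPP hPQ, hB]
    exact integral_cos_smul_add_sin_smul_gaussianReal μ v Q B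
  have integral_conj_self {P : Matrix (Fin 2) (Fin 2) ℂ} (hP : P.IsHermitian)
      (hPP : P * P = 1) : EG (fun x => rotG P x * P * (rotG P x)ᴴ) = P := by
    rw [hEG]
    ext i j
    simp [rotG_conj_of_commute hP hPP rfl]
  refine ⟨integral_conj PZ_isHermitian PZ_mul_self ?_ ?_, ?_,
    integral_conj_self PZ_isHermitian PZ_mul_self,
    integral_conj PY_isHermitian PY_mul_self ?_ ?_, ?_,
    integral_conj_self PY_isHermitian PY_mul_self⟩
  · simp [PX, PZ]
  · simp [PX, PY, PZ]
  · refine (integral_conj (B := -PX) PZ_isHermitian PZ_mul_self ?_ ?_).trans ?_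
    · simp [PY, PZ]
    · simp [PX, PY, PZ]
    · rw [smul_neg, add_comm]
  · simp [PY, PZ]
  · simp [PX, PY, PZ]
  · refine (integral_conj (B := -PZ) PY_isHermitian PY_mul_self ?_ ?_).trans ?_
    · simp [PX, PY]
    · simp [PX, PY, PZ]
    · rw [smul_neg, add_comm]
end
end

section
/- Let x = (x₁, x₂, x₃) have independent real Gaussian entries x_i ~ N(μ_i, σ_i²) with σ_i² ≥ σ² for all i ∈ [3], and let R(x) = R_z(x₃) R_y(x₂) R_z(x₁). Define the 3×3 real matrix 𝒯 whose entry in row b and column a (for a, b ranging over the ordered non-identity Pauli basis (Z, X, Y)) is (1/2)·E[Tr[σ_b R(x) σ_a R(x)†]]. Then 𝒯ᵀ𝒯 is Hermitian and every eigenvalue of 𝒯ᵀ𝒯 is at most e^{−σ²}; equivalently, the largest singular value of 𝒯 is at most e^{−σ²/2}. -/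
open Matrix MeasureTheory ProbabilityTheory
open scoped NNReal ENNReal ComplexOrder

noncomputable section

/-- The non-identity single-qubit Pauli basis, ordered `(Z, X, Y)`. -/
def pauliNI : Fin 3 → Matrix (Fin 2) (Fin 2) ℂ := ![PZ, PX, PY]

/-- Action of `Rz φ` by conjugation on the Pauli basis `(Z, X, Y)`, written with
`c = cos φ` and `s = sin φ`. -/
def zBlock (c s : ℝ) : Matrix (Fin 3) (Fin 3) ℝ := !![1, 0, 0; 0, c, -s; 0, s, c]

/-- Action of `Ry φ` by conjugation on the Pauli basis `(Z, X, Y)`, written with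
`c = cos φ` and `s = sin φ`. -/
def yBlock (c s : ℝ) : Matrix (Fin 3) (Fin 3) ℝ := !![c, -s, 0; s, c, 0; 0, 0, 1]

lemma ofReal_cos_eq_half (φ : ℝ) :
    (Real.cos φ : ℂ) = (Real.cos (φ / 2) : ℂ) ^ 2 - (Real.sin (φ / 2) : ℂ) ^ 2 := by
  rw [← Complex.ofReal_pow, ← Complex.ofReal_pow, ← Complex.ofReal_sub, ← Real.cos_two_mul',
    mul_div_cancel₀ φ two_ne_zero]

lemma ofReal_sin_eq_half (φ : ℝ) :
    (Real.sin φ : ℂ) = 2 * (Real.sin (φ / 2) : ℂ) * (Real.cos (φ / 2) : ℂ) := by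
  rw [← Complex.ofReal_ofNat, ← Complex.ofReal_mul, ← Complex.ofReal_mul, ← Real.sin_two_mul,
    mul_div_cancel₀ φ two_ne_zero]

lemma ofReal_half_sq_add_sq (φ : ℝ) :
    (Real.cos (φ / 2) : ℂ) ^ 2 + (Real.sin (φ / 2) : ℂ) ^ 2 = 1 := by
  exact_mod_cast Real.cos_sq_add_sin_sq (φ / 2)

lemma Rz_conj_pauli (φ : ℝ) (a : Fin 3) :
    Rz φ * pauliNI a * (Rz φ)ᴴ =
      ∑ b, (zBlock (Real.cos φ) (Real.sin φ) b a : ℂ) • pauliNI b := by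
  have h := ofReal_half_sq_add_sq φ
  fin_cases a <;> ext i j <;> fin_cases i <;> fin_cases j <;>
    simp [Rz, rotG, pauliNI, PZ, PX, PY, zBlock, Fin.sum_univ_three, Matrix.mul_apply,
      -Complex.ofReal_cos, -Complex.ofReal_sin, ofReal_cos_eq_half φ, ofReal_sin_eq_half φ] <;>
    grind [Complex.I_sq]

lemma Ry_conj_pauli (φ : ℝ) (a : Fin 3) :
    Ry φ * pauliNI a * (Ry φ)ᴴ =
      ∑ b, (yBlock (Real.cos φ) (Real.sin φ) b a : ℂ) • pauliNI b := by
  have h := ofReal_half_sq_add_sq φ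
  fin_cases a <;> ext i j <;> fin_cases i <;> fin_cases j <;>
    simp [Ry, rotG, pauliNI, PZ, PX, PY, yBlock, Fin.sum_univ_three, Matrix.mul_apply,
      -Complex.ofReal_cos, -Complex.ofReal_sin, ofReal_cos_eq_half φ, ofReal_sin_eq_half φ] <;>
    grind [Complex.I_sq]

/-- The action of `encGate x` by conjugation on the Pauli basis `(Z, X, Y)`. -/
def encBlock (x : Fin 3 → ℝ) : Matrix (Fin 3) (Fin 3) ℝ :=
  zBlock (Real.cos (x 2)) (Real.sin (x 2)) * yBlock (Real.cos (x 1)) (Real.sin (x 1)) *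
    zBlock (Real.cos (x 0)) (Real.sin (x 0))

lemma conj_mul_pauli {U V : Matrix (Fin 2) (Fin 2) ℂ} {A B : Matrix (Fin 3) (Fin 3) ℝ}
    (hU : ∀ a, U * pauliNI a * Uᴴ = ∑ b, (A b a : ℂ) • pauliNI b)
    (hV : ∀ a, V * pauliNI a * Vᴴ = ∑ b, (B b a : ℂ) • pauliNI b) (a : Fin 3) :
    (U * V) * pauliNI a * (U * V)ᴴ = ∑ b, ((A * B) b a : ℂ) • pauliNI b := by
  have h : (U * V) * pauliNI a * (U * V)ᴴ = U * (V * pauliNI a * Vᴴ) * Uᴴ := by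
    simp only [conjTranspose_mul, Matrix.mul_assoc]
  simp only [h, hV, Matrix.mul_sum, Matrix.sum_mul, Matrix.mul_smul, Matrix.smul_mul, hU,
    Finset.smul_sum, smul_smul, Matrix.mul_apply, Complex.ofReal_sum, Complex.ofReal_mul,
    Finset.sum_smul]
  rw [Finset.sum_comm]
  simp only [mul_comm]

lemma encGate_conj_pauli (x : Fin 3 → ℝ) (a : Fin 3) :
    encGate x * pauliNI a * (encGate x)ᴴ = ∑ b, (encBlock x b a : ℂ) • pauliNI b :=
  conj_mul_pauli (conj_mul_pauli (Rz_conj_pauli _) (Ry_conj_pauli _)) (Rz_conj_pauli _) a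

lemma trace_pauli_mul (b c : Fin 3) :
    (pauliNI b * pauliNI c).trace = if b = c then 2 else 0 := by
  fin_cases b <;> fin_cases c <;>
    simp [pauliNI, PZ, PX, PY, Matrix.trace_fin_two, one_add_one_eq_two]

lemma trace_encGate (x : Fin 3 → ℝ) (b a : Fin 3) :
    (pauliNI b * encGate x * pauliNI a * (encGate x)ᴴ).trace = ((2 * encBlock x b a : ℝ) : ℂ) := by
  have h : pauliNI b * encGate x * pauliNI a * (encGate x)ᴴ =
      pauliNI b * (encGate x * pauliNI a * (encGate x)ᴴ) := by
    simp only [Matrix.mul_assoc]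
  simp [h, encGate_conj_pauli, Matrix.mul_sum, trace_pauli_mul, mul_comm]

lemma integrable_zBlock (ν : Measure ℝ) [IsProbabilityMeasure ν] (i j : Fin 3) :
    Integrable (fun t => zBlock (Real.cos t) (Real.sin t) i j) ν := by
  have hc : Integrable Real.cos ν := .of_bound (by fun_prop) 1 (.of_forall Real.abs_cos_le_one)
  have hs : Integrable Real.sin ν := .of_bound (by fun_prop) 1 (.of_forall Real.abs_sin_le_one)
  fin_cases i <;> fin_cases j <;> simp [zBlock, hc, hs]

lemma integral_zBlock (ν : Measure ℝ) [IsProbabilityMeasure ν] (i j : Fin 3) :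
    ∫ t, zBlock (Real.cos t) (Real.sin t) i j ∂ν =
      zBlock (∫ t, Real.cos t ∂ν) (∫ t, Real.sin t ∂ν) i j := by
  fin_cases i <;> fin_cases j <;> simp [zBlock, integral_neg]

lemma integrable_yBlock (ν : Measure ℝ) [IsProbabilityMeasure ν] (i j : Fin 3) :
    Integrable (fun t => yBlock (Real.cos t) (Real.sin t) i j) ν := by
  have hc : Integrable Real.cos ν := .of_bound (by fun_prop) 1 (.of_forall Real.abs_cos_le_one)
  have hs : Integrable Real.sin ν := .of_bound (by fun_prop) 1 (.of_forall Real.abs_sin_le_one)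
  fin_cases i <;> fin_cases j <;> simp [yBlock, hc, hs]

lemma integral_yBlock (ν : Measure ℝ) [IsProbabilityMeasure ν] (i j : Fin 3) :
    ∫ t, yBlock (Real.cos t) (Real.sin t) i j ∂ν =
      yBlock (∫ t, Real.cos t ∂ν) (∫ t, Real.sin t ∂ν) i j := by
  fin_cases i <;> fin_cases j <;> simp [yBlock, integral_neg]

lemma integral_encBlock (ν : Fin 3 → Measure ℝ) [∀ i, IsProbabilityMeasure (ν i)] (b a : Fin 3) :
    ∫ x, encBlock x b a ∂Measure.pi ν =
      (zBlock (∫ t, Real.cos t ∂ν 2) (∫ t, Real.sin t ∂ν 2) *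
        yBlock (∫ t, Real.cos t ∂ν 1) (∫ t, Real.sin t ∂ν 1) *
        zBlock (∫ t, Real.cos t ∂ν 0) (∫ t, Real.sin t ∂ν 0)) b a := by
  let f (k l : Fin 3) : Fin 3 → ℝ → ℝ := ![fun t => zBlock (Real.cos t) (Real.sin t) l a,
    fun t => yBlock (Real.cos t) (Real.sin t) k l, fun t => zBlock (Real.cos t) (Real.sin t) b k]
  have hf (k l i) : Integrable (f k l i) (ν i) := by
    fin_cases i
    exacts [integrable_zBlock _ _ _, integrable_yBlock _ _ _, integrable_zBlock _ _ _]
  have hprod (k l) : Integrable (fun x : Fin 3 → ℝ => ∏ i, f k l i (x i)) (Measure.pi ν) :=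
    Integrable.fintype_prod (hf k l)
  have henc (x : Fin 3 → ℝ) : encBlock x b a = ∑ l, ∑ k, ∏ i, f k l i (x i) := by
    simp only [encBlock, Matrix.mul_apply, Finset.sum_mul, Fin.prod_univ_three, f]
    refine Finset.sum_congr rfl fun l _ => Finset.sum_congr rfl fun k _ => ?_
    simp only [cons_val]
    ring
  simp only [henc]
  rw [integral_finsetSum _ fun l _ => integrable_finsetSum _ fun k _ => hprod k l]
  simp only [Matrix.mul_apply, Finset.sum_mul]
  refine Finset.sum_congr rfl fun l _ => ?_
  rw [integral_finsetSum _ fun k _ => hprod k l]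
  refine Finset.sum_congr rfl fun k _ => ?_
  rw [integral_fintype_prod_eq_prod]
  simp only [Fin.prod_univ_three, f, cons_val, integral_zBlock, integral_yBlock]
  ring

lemma integral_cos_sq_add_integral_sin_sq_gaussianReal (μ : ℝ) (v : ℝ≥0) :
    (∫ t, Real.cos t ∂gaussianReal μ v) ^ 2 + (∫ t, Real.sin t ∂gaussianReal μ v) ^ 2 =
      Real.exp (-v) := by
  have hint : Integrable (fun t : ℝ => Complex.exp (t * Complex.I)) (gaussianReal μ v) :=
    .of_bound (by fun_prop) 1 (.of_forall fun t => (Complex.norm_exp_ofReal_mul_I t).le)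
  have h := charFun_gaussianReal (μ := μ) (v := v) 1
  simp only [charFun_apply_real, Complex.ofReal_one, one_mul] at h
  have hre : ∫ t, Real.cos t ∂gaussianReal μ v =
      (∫ t : ℝ, Complex.exp (t * Complex.I) ∂gaussianReal μ v).re := by
    simpa [Complex.exp_ofReal_mul_I_re] using integral_re hint
  have him : ∫ t, Real.sin t ∂gaussianReal μ v =
      (∫ t : ℝ, Complex.exp (t * Complex.I) ∂gaussianReal μ v).im := by
    simpa [Complex.exp_ofReal_mul_I_im] using integral_im hint
  rw [hre, him, h, pow_two (Complex.re _), pow_two (Complex.im _), ← Complex.normSq_apply,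
    Complex.normSq_eq_norm_sq, Complex.norm_exp, ← Real.exp_nat_mul]
  congr 1
  simp
  ring

lemma dotProduct_zBlock_mulVec_self (c s : ℝ) (w : Fin 3 → ℝ) :
    (zBlock c s *ᵥ w) ⬝ᵥ (zBlock c s *ᵥ w) = w 0 ^ 2 + (c ^ 2 + s ^ 2) * (w 1 ^ 2 + w 2 ^ 2) := by
  simp [zBlock, Matrix.mulVec, dotProduct, Fin.sum_univ_three]
  ring

lemma dotProduct_yBlock_mulVec_self (c s : ℝ) (w : Fin 3 → ℝ) :
    (yBlock c s *ᵥ w) ⬝ᵥ (yBlock c s *ᵥ w) = (c ^ 2 + s ^ 2) * (w 0 ^ 2 + w 1 ^ 2) + w 2 ^ 2 := by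
  simp [yBlock, Matrix.mulVec, dotProduct, Fin.sum_univ_three]
  ring

/-- If all three planar blocks contract squared lengths by `q ≤ 1`, so does the product. -/
lemma dotProduct_block_mulVec_self_le {q : ℝ} (hq : q ≤ 1) {c s : Fin 3 → ℝ}
    (h : ∀ i, c i ^ 2 + s i ^ 2 ≤ q) (w : Fin 3 → ℝ) :
    ((zBlock (c 2) (s 2) * yBlock (c 1) (s 1) * zBlock (c 0) (s 0)) *ᵥ w) ⬝ᵥ
      ((zBlock (c 2) (s 2) * yBlock (c 1) (s 1) * zBlock (c 0) (s 0)) *ᵥ w) ≤ q * (w ⬝ᵥ w) := by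
  simp only [← Matrix.mulVec_mulVec]
  set u := zBlock (c 0) (s 0) *ᵥ w with hu
  set y := yBlock (c 1) (s 1) *ᵥ u with hy
  have hzw : u 1 ^ 2 + u 2 ^ 2 = (c 0 ^ 2 + s 0 ^ 2) * (w 1 ^ 2 + w 2 ^ 2) := by
    simp [hu, zBlock, dotProduct, Fin.sum_univ_three]
    ring
  have hu0 : u 0 = w 0 := by
    simp [hu, zBlock, dotProduct, Fin.sum_univ_three]
  have hyy := dotProduct_yBlock_mulVec_self (c 1) (s 1) u
  rw [← hy] at hyy
  rw [dotProduct_zBlock_mulVec_self]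
  simp only [dotProduct, Fin.sum_univ_three] at hyy ⊢
  have h2 := mul_le_mul_of_nonneg_right ((h 2).trans hq) (by positivity : 0 ≤ y 1 ^ 2 + y 2 ^ 2)
  have h1 := mul_le_mul_of_nonneg_right (h 1) (sq_nonneg (u 0))
  have h1' := mul_le_mul_of_nonneg_right ((h 1).trans hq) (sq_nonneg (u 1))
  have h0 := mul_le_mul_of_nonneg_right (h 0) (by positivity : 0 ≤ w 1 ^ 2 + w 2 ^ 2)
  rw [hu0] at h1 hyy
  linarith

lemma Matrix.IsHermitian.eigenvalues_transpose_mul_self_le {n : Type*} [Fintype n] [DecidableEq n]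
    {A : Matrix n n ℝ} (hH : (Aᵀ * A).IsHermitian) {q : ℝ}
    (h : ∀ w, (A *ᵥ w) ⬝ᵥ (A *ᵥ w) ≤ q * (w ⬝ᵥ w)) (i : n) : hH.eigenvalues i ≤ q := by
  set w : n → ℝ := ⇑(hH.eigenvectorBasis i) with hw
  have hunit : w ⬝ᵥ w = 1 := by
    have := hH.eigenvectorBasis.orthonormal.1 i
    rw [EuclideanSpace.norm_eq, Real.sqrt_eq_one] at this
    simpa [dotProduct, hw, sq] using this
  have hle := h w
  rw [hunit, mul_one] at hle
  have heig : (A *ᵥ w) ⬝ᵥ (A *ᵥ w) = hH.eigenvalues i := by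
    rw [dotProduct_mulVec, ← mulVec_transpose, mulVec_mulVec, hw, hH.mulVec_eigenvectorBasis,
      smul_dotProduct, ← hw, hunit, smul_eq_mul, mul_one]
  exact heig ▸ hle

/-- For `x = (x₁,x₂,x₃)` with independent Gaussian entries whose
variances are all at least `σ²`, the non-identity block `𝒯` of the expected Pauli-basis
transfer matrix of the encoding gate `R(x)` satisfies: `𝒯ᵀ𝒯` is Hermitian and all of
its eigenvalues are at most `e^{−σ²}` (equivalently, the largest singular value of `𝒯`
is at most `e^{−σ²/2}`). -/
theorem statement10
    (μ : Fin 3 → ℝ) (v : Fin 3 → ℝ≥0)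
    (σ2 : ℝ) (hσ2 : 0 < σ2) (hv : ∀ i, σ2 ≤ (v i : ℝ))
    -- the product Gaussian measure on the data
    (μx : Measure (Fin 3 → ℝ))
    (hμx : μx = Measure.pi fun i => gaussianReal (μ i) (v i))
    -- the (real) 3×3 block `𝒯` of the expected transfer matrix, over the basis `(Z,X,Y)`
    (T : Matrix (Fin 3) (Fin 3) ℝ)
    (hT : ∀ b a, T b a =
      ((1 / 2 : ℂ) *
        ∫ x, (pauliNI b * encGate x * pauliNI a * (encGate x)ᴴ).trace ∂μx).re) :
    ∃ hH : (Tᵀ * T).IsHermitian, ∀ i, hH.eigenvalues i ≤ Real.exp (-σ2) := by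
  have hT' : T = zBlock (∫ t, Real.cos t ∂gaussianReal (μ 2) (v 2))
        (∫ t, Real.sin t ∂gaussianReal (μ 2) (v 2)) *
      yBlock (∫ t, Real.cos t ∂gaussianReal (μ 1) (v 1))
        (∫ t, Real.sin t ∂gaussianReal (μ 1) (v 1)) *
      zBlock (∫ t, Real.cos t ∂gaussianReal (μ 0) (v 0))
        (∫ t, Real.sin t ∂gaussianReal (μ 0) (v 0)) := by
    ext b a
    rw [hT, hμx, ← integral_encBlock fun i => gaussianReal (μ i) (v i)]
    simp only [trace_encGate]
    rw [integral_complex_ofReal, integral_const_mul]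
    simp
  have hH : (Tᵀ * T).IsHermitian := by
    simpa using isHermitian_conjTranspose_mul_self T
  refine ⟨hH, hH.eigenvalues_transpose_mul_self_le fun w => ?_⟩
  rw [hT']
  refine dotProduct_block_mulVec_self_le (Real.exp_le_one_iff.2 (by linarith))
    (c := fun i => ∫ t, Real.cos t ∂gaussianReal (μ i) (v i))
    (s := fun i => ∫ t, Real.sin t ∂gaussianReal (μ i) (v i)) (fun i => ?_) w
  rw [integral_cos_sq_add_integral_sin_sq_gaussianReal]
  exact Real.exp_le_exp.2 (neg_le_neg (hv i))
end
end

section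
/- Let ρ be a single-qubit density matrix with Pauli decomposition ρ = (1/2)(α_I·I + α_Z·Z + α_X·X + α_Y·Y), where α_P = Tr[ρP]. Let x = (x₁, x₂, x₃) have independent real Gaussian entries x_i ~ N(μ_i, σ_i²) with σ_i² ≥ σ² for all i, and let E[ρ'] = E_x[R(x) ρ R(x)†] with Pauli coefficients β_P = Tr[E[ρ']·P]. Then β_I = α_I = 1, and β_Z² + β_X² + β_Y² ≤ e^{−σ²}·(α_Z² + α_X² + α_Y²): the squared norm of the non-identity Pauli coefficients contracts by at least the factor e^{−σ²} under a single expected encoding gate. -/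
open Matrix MeasureTheory ProbabilityTheory
open scoped NNReal ENNReal ComplexOrder

noncomputable section

/-- The single-qubit Pauli basis in the order `(I, Z, X, Y)`. -/
def pauli1 : Fin 4 → Matrix (Fin 2) (Fin 2) ℂ := ![1, PZ, PX, PY]

/-- The `N`-qubit Pauli basis: all `N`-fold Kronecker products of `{I, Z, X, Y}`. -/
def pauliN {N : ℕ} (s : Fin N → Fin 4) : Matrix (Fin N → Fin 2) (Fin N → Fin 2) ℂ :=
  kron fun n => pauli1 (s n)

/-- The matrix `(1/2)(I + x X + y Y + z Z)` with Bloch vector `(x, y, z)`. -/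
def blochMatrix (x y z : ℝ) : Matrix (Fin 2) (Fin 2) ℂ :=
  !![(1 + (z : ℂ)) / 2, (x - Complex.I * y) / 2; (x + Complex.I * y) / 2, (1 - (z : ℂ)) / 2]

lemma Matrix.PosSemidef.eq_blochMatrix {ρ : Matrix (Fin 2) (Fin 2) ℂ} (hρ : ρ.PosSemidef)
    (htr : ρ.trace = 1) :
    ρ = blochMatrix (ρ * PX).trace.re (ρ * PY).trace.re (ρ * PZ).trace.re := by
  have h := hρ.isHermitian
  have h00 := congrArg Complex.im (h.apply 0 0)
  have h11 := congrArg Complex.im (h.apply 1 1)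
  have h01 := h.apply 0 1
  rw [Matrix.trace_fin_two] at htr
  have hre := congrArg Complex.re htr
  have h01re := congrArg Complex.re h01
  have h01im := congrArg Complex.im h01
  simp at h00 h11 hre h01re h01im
  ext i j
  fin_cases i <;> fin_cases j <;> apply Complex.ext <;>
    simp [blochMatrix, PX, PY, PZ, Matrix.trace_fin_two, Matrix.mul_apply, Fin.sum_univ_two] <;>
    linarith

lemma blochMatrix_trace (x y z : ℝ) : (blochMatrix x y z).trace = 1 := by
  simp [blochMatrix, Matrix.trace_fin_two]
  ring

lemma blochMatrix_mul_PX_trace (x y z : ℝ) : (blochMatrix x y z * PX).trace = x := by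
  simp [blochMatrix, PX, Matrix.trace_fin_two]
  ring

lemma blochMatrix_mul_PY_trace (x y z : ℝ) : (blochMatrix x y z * PY).trace = y := by
  simp [blochMatrix, PY, Matrix.trace_fin_two]
  ring_nf
  simp

lemma blochMatrix_mul_PZ_trace (x y z : ℝ) : (blochMatrix x y z * PZ).trace = z := by
  simp [blochMatrix, PZ, Matrix.trace_fin_two]
  ring

lemma cos_eq_sq_half_sub (φ : ℝ) :
    Real.cos φ = Real.cos (φ / 2) ^ 2 - Real.sin (φ / 2) ^ 2 := by
  rw [← Real.cos_two_mul', mul_div_cancel₀ φ two_ne_zero]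

lemma sin_eq_two_mul_half (φ : ℝ) :
    Real.sin φ = 2 * Real.sin (φ / 2) * Real.cos (φ / 2) := by
  rw [← Real.sin_two_mul, mul_div_cancel₀ φ two_ne_zero]

lemma Rz_conj_blochMatrix (φ x y z : ℝ) :
    Rz φ * blochMatrix x y z * (Rz φ)ᴴ =
      blochMatrix (Real.cos φ * x - Real.sin φ * y) (Real.sin φ * x + Real.cos φ * y) z := by
  have h := Real.sin_sq_add_cos_sq (φ / 2)
  rw [cos_eq_sq_half_sub φ, sin_eq_two_mul_half φ]
  simp only [Rz, rotG]
  generalize Real.cos (φ / 2) = c at *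
  generalize Real.sin (φ / 2) = s at *
  ext i j
  fin_cases i <;> fin_cases j <;> apply Complex.ext <;>
    simp [blochMatrix, PZ, Matrix.mul_apply, Fin.sum_univ_two, -Complex.ofReal_pow] <;>
    grind

lemma Ry_conj_blochMatrix (φ x y z : ℝ) :
    Ry φ * blochMatrix x y z * (Ry φ)ᴴ =
      blochMatrix (Real.cos φ * x + Real.sin φ * z) y (Real.cos φ * z - Real.sin φ * x) := by
  have h := Real.sin_sq_add_cos_sq (φ / 2)
  rw [cos_eq_sq_half_sub φ, sin_eq_two_mul_half φ]
  simp only [Ry, rotG]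
  generalize Real.cos (φ / 2) = c at *
  generalize Real.sin (φ / 2) = s at *
  ext i j
  fin_cases i <;> fin_cases j <;> apply Complex.ext <;>
    simp [blochMatrix, PY, Matrix.mul_apply, Fin.sum_univ_two, -Complex.ofReal_pow] <;>
    grind

lemma encGate_conj_blochMatrix (w : Fin 3 → ℝ) (x y z : ℝ) :
    encGate w * blochMatrix x y z * (encGate w)ᴴ =
      let x₁ := Real.cos (w 0) * x - Real.sin (w 0) * y
      let y₁ := Real.sin (w 0) * x + Real.cos (w 0) * y
      let x₂ := Real.cos (w 1) * x₁ + Real.sin (w 1) * z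
      blochMatrix (Real.cos (w 2) * x₂ - Real.sin (w 2) * y₁)
        (Real.sin (w 2) * x₂ + Real.cos (w 2) * y₁)
        (Real.cos (w 1) * z - Real.sin (w 1) * x₁) := by
  have h : encGate w * blochMatrix x y z * (encGate w)ᴴ =
      Rz (w 2) * (Ry (w 1) * (Rz (w 0) * blochMatrix x y z * (Rz (w 0))ᴴ) * (Ry (w 1))ᴴ) *
        (Rz (w 2))ᴴ := by
    simp only [encGate, Matrix.conjTranspose_mul, Matrix.mul_assoc]
  rw [h, Rz_conj_blochMatrix, Ry_conj_blochMatrix, Rz_conj_blochMatrix]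

lemma integral_blochMatrix {Ω : Type*} [MeasurableSpace Ω] (P : Measure Ω)
    [IsProbabilityMeasure P] {X Y Z : Ω → ℝ} (hX : Integrable X P) (hY : Integrable Y P)
    (hZ : Integrable Z P) :
    (Matrix.of fun i j => ∫ ω, blochMatrix (X ω) (Y ω) (Z ω) i j ∂P) =
      blochMatrix (∫ ω, X ω ∂P) (∫ ω, Y ω ∂P) (∫ ω, Z ω ∂P) := by
  have hX' : Integrable (fun ω => (X ω : ℂ)) P := hX.ofReal
  have hY' : Integrable (fun ω => Complex.I * (Y ω : ℂ)) P := hY.ofReal.const_mul _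
  have hZ' : Integrable (fun ω => (Z ω : ℂ)) P := hZ.ofReal
  have h1 : Integrable (fun _ : Ω => (1 : ℂ)) P := integrable_const _
  ext i j
  fin_cases i <;> fin_cases j <;>
    simp [blochMatrix, integral_div, integral_add h1 hZ', integral_sub h1 hZ',
      integral_add hX' hY', integral_sub hX' hY', integral_const_mul, integral_complex_ofReal]

lemma integrable_cos (P : Measure ℝ) [IsFiniteMeasure P] : Integrable Real.cos P :=
  Integrable.of_bound Real.continuous_cos.aestronglyMeasurable 1
    (ae_of_all _ fun x => Real.abs_cos_le_one x)

lemma integrable_sin (P : Measure ℝ) [IsFiniteMeasure P] : Integrable Real.sin P :=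
  Integrable.of_bound Real.continuous_sin.aestronglyMeasurable 1
    (ae_of_all _ fun x => Real.abs_sin_le_one x)

lemma charFun_one_eq_integral_cos_sin (P : Measure ℝ) [IsFiniteMeasure P] :
    charFun P 1 = (∫ x, Real.cos x ∂P : ℝ) + (∫ x, Real.sin x ∂P : ℝ) * Complex.I := by
  rw [charFun_apply_real, ← integral_complex_ofReal, ← integral_complex_ofReal,
    ← integral_mul_const, ← integral_add (integrable_cos P).ofReal
      ((integrable_sin P).ofReal.mul_const _)]
  refine integral_congr_ae (ae_of_all _ fun x => ?_)
  simp [Complex.exp_mul_I]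

lemma sq_integral_cos_add_sq_integral_sin_gaussianReal (m : ℝ) (v : ℝ≥0) :
    (∫ x, Real.cos x ∂gaussianReal m v) ^ 2 + (∫ x, Real.sin x ∂gaussianReal m v) ^ 2 =
      Real.exp (-v) := by
  have h := congrArg Complex.normSq
    ((charFun_one_eq_integral_cos_sin (gaussianReal m v)).symm.trans (charFun_gaussianReal 1))
  rw [Complex.normSq_add_mul_I, Complex.normSq_eq_norm_sq, Complex.norm_exp] at h
  rw [h, ← Real.exp_nat_mul]
  congr 1
  have : ((v : ℂ) / 2).re = (v : ℝ) / 2 := by simp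
  simp [this]
  ring

/-- `f` is integrable with expectation `a`. -/
def HasMean {Ω : Type*} [MeasurableSpace Ω] (P : Measure Ω) (f : Ω → ℝ) (a : ℝ) : Prop :=
  Integrable f P ∧ ∫ ω, f ω ∂P = a

namespace HasMean

variable {Ω : Type*} [MeasurableSpace Ω] {P : Measure Ω} {f g : Ω → ℝ} {a b : ℝ}

lemma add (hf : HasMean P f a) (hg : HasMean P g b) :
    HasMean P (fun ω => f ω + g ω) (a + b) :=
  ⟨hf.1.add hg.1, by rw [integral_add hf.1 hg.1, hf.2, hg.2]⟩

lemma sub (hf : HasMean P f a) (hg : HasMean P g b) :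
    HasMean P (fun ω => f ω - g ω) (a - b) :=
  ⟨hf.1.sub hg.1, by rw [integral_sub hf.1 hg.1, hf.2, hg.2]⟩

lemma mul_const (hf : HasMean P f a) (c : ℝ) : HasMean P (fun ω => f ω * c) (a * c) :=
  ⟨hf.1.mul_const c, by rw [integral_mul_const, hf.2]⟩

lemma one [IsProbabilityMeasure P] : HasMean P (fun _ => 1) 1 :=
  ⟨integrable_const _, by simp⟩

lemma pi_mul_mul {P : Fin 3 → Measure ℝ} [∀ i, IsProbabilityMeasure (P i)] {f g h : ℝ → ℝ}
    {a b c : ℝ} (hf : HasMean (P 0) f a) (hg : HasMean (P 1) g b) (hh : HasMean (P 2) h c) :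
    HasMean (Measure.pi P) (fun w => f (w 0) * g (w 1) * h (w 2)) (a * b * c) := by
  constructor
  · have := Integrable.fintype_prod (μ := P) (f := (![f, g, h] : Fin 3 → ℝ → ℝ))
      (by intro i; fin_cases i; exacts [hf.1, hg.1, hh.1])
    simpa [Fin.prod_univ_three] using this
  · rw [← hf.2, ← hg.2, ← hh.2]
    simpa [Fin.prod_univ_three] using
      integral_fintype_prod_eq_prod (μ := P) (f := (![f, g, h] : Fin 3 → ℝ → ℝ))

end HasMean

/-- The expected encoding gate acts on Bloch vectors by the rotation formulas in which each
`cos (w i)` and `sin (w i)` is replaced by its expectation. -/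
lemma integral_encGate_conj_blochMatrix (P : Fin 3 → Measure ℝ)
    [∀ i, IsProbabilityMeasure (P i)] (x y z : ℝ) :
    let C := fun i => ∫ t, Real.cos t ∂(P i)
    let S := fun i => ∫ t, Real.sin t ∂(P i)
    let x₁ := C 0 * x - S 0 * y
    let y₁ := S 0 * x + C 0 * y
    let x₂ := C 1 * x₁ + S 1 * z
    (Matrix.of fun i j =>
      ∫ w, (encGate w * blochMatrix x y z * (encGate w)ᴴ) i j ∂(Measure.pi P)) =
      blochMatrix (C 2 * x₂ - S 2 * y₁) (S 2 * x₂ + C 2 * y₁) (C 1 * z - S 1 * x₁) := by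
  intro C S x₁ y₁ x₂
  have hC (i) : HasMean (P i) Real.cos (C i) := ⟨integrable_cos _, rfl⟩
  have hS (i) : HasMean (P i) Real.sin (S i) := ⟨integrable_sin _, rfl⟩
  have h1 (i) : HasMean (P i) (fun _ => 1) 1 := HasMean.one
  have hx₂ {h : ℝ → ℝ} {c : ℝ} (hh : HasMean (P 2) h c) :=
    ((((hC 0).pi_mul_mul (hC 1) hh).mul_const x).sub
      (((hS 0).pi_mul_mul (hC 1) hh).mul_const y)).add
      (((h1 0).pi_mul_mul (hS 1) hh).mul_const z)
  have hy₁ {h : ℝ → ℝ} {c : ℝ} (hh : HasMean (P 2) h c) :=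
    (((hS 0).pi_mul_mul (h1 1) hh).mul_const x).add
      (((hC 0).pi_mul_mul (h1 1) hh).mul_const y)
  have hX := (hx₂ (hC 2)).sub (hy₁ (hS 2))
  have hY := (hx₂ (hS 2)).add (hy₁ (hC 2))
  have hZ := (((h1 0).pi_mul_mul (hC 1) (h1 2)).mul_const z).sub
    ((((hC 0).pi_mul_mul (hS 1) (h1 2)).mul_const x).sub
      (((hS 0).pi_mul_mul (hS 1) (h1 2)).mul_const y))
  have key := integral_blochMatrix (Measure.pi P) hX.1 hY.1 hZ.1
  rw [hX.2, hY.2, hZ.2] at key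
  convert key using 1
  · ext i j
    simp only [Matrix.of_apply, encGate_conj_blochMatrix]
    congr 1
    funext w
    congr 2 <;> ring
  · simp only [x₂, y₁, x₁]
    congr 1 <;> ring

/-- Planar rotation-like maps scale the squared norm by `c ^ 2 + s ^ 2`; composing three of them
in the pattern of the encoding gate contracts the norm by a common bound on these factors. -/
lemma encGate_contraction {C S : Fin 3 → ℝ} {q : ℝ} (hq : q ≤ 1)
    (h : ∀ i, C i ^ 2 + S i ^ 2 ≤ q) (x y z : ℝ) :
    let x₁ := C 0 * x - S 0 * y
    let y₁ := S 0 * x + C 0 * y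
    let x₂ := C 1 * x₁ + S 1 * z
    (C 1 * z - S 1 * x₁) ^ 2 + (C 2 * x₂ - S 2 * y₁) ^ 2 + (S 2 * x₂ + C 2 * y₁) ^ 2 ≤
      q * (z ^ 2 + x ^ 2 + y ^ 2) := by
  intro x₁ y₁ x₂
  calc (C 1 * z - S 1 * x₁) ^ 2 + (C 2 * x₂ - S 2 * y₁) ^ 2 + (S 2 * x₂ + C 2 * y₁) ^ 2
      = (C 1 * z - S 1 * x₁) ^ 2 + (C 2 ^ 2 + S 2 ^ 2) * (x₂ ^ 2 + y₁ ^ 2) := by ring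
    _ ≤ (C 1 * z - S 1 * x₁) ^ 2 + 1 * (x₂ ^ 2 + y₁ ^ 2) := by
      gcongr
      exact (h 2).trans hq
    _ = (C 1 ^ 2 + S 1 ^ 2) * z ^ 2 + (C 1 ^ 2 + S 1 ^ 2) * x₁ ^ 2 + y₁ ^ 2 := by
      simp only [x₂]
      ring
    _ ≤ q * z ^ 2 + 1 * x₁ ^ 2 + y₁ ^ 2 := by
      gcongr
      · exact h 1
      · exact (h 1).trans hq
    _ = q * z ^ 2 + (C 0 ^ 2 + S 0 ^ 2) * (x ^ 2 + y ^ 2) := by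
      simp only [x₁, y₁]
      ring
    _ ≤ q * z ^ 2 + q * (x ^ 2 + y ^ 2) := by
      gcongr
      exact h 0
    _ = q * (z ^ 2 + x ^ 2 + y ^ 2) := by ring

/-- Let `ρ` be a single-qubit density matrix with Pauli coefficients
`α_P = Tr[ρP]` (ordered basis `(I,Z,X,Y)`), and let `E[ρ'] = E_x[R(x) ρ R(x)†]` for
`x = (x₁,x₂,x₃)` with independent Gaussian entries whose variances are at least `σ²`,
with Pauli coefficients `β_P`. Then `β_I = α_I = 1` and
`β_Z² + β_X² + β_Y² ≤ e^{−σ²}·(α_Z² + α_X² + α_Y²)`. -/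
theorem statement11
    (ρ : Matrix (Fin 2) (Fin 2) ℂ) (hρ : ρ.PosSemidef) (htr : ρ.trace = 1)
    (μ : Fin 3 → ℝ) (v : Fin 3 → ℝ≥0)
    (σ2 : ℝ) (hσ2 : 0 < σ2) (hv : ∀ i, σ2 ≤ (v i : ℝ))
    -- Pauli coefficients of `ρ`
    (α : Fin 4 → ℝ) (hα : ∀ P, α P = ((ρ * pauli1 P).trace).re)
    -- the expected encoded state `E[ρ'] = E_x[R(x) ρ R(x)†]` (entrywise expectation)
    (Eρ : Matrix (Fin 2) (Fin 2) ℂ)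
    (hE : Eρ = Matrix.of fun i j =>
      ∫ x, (encGate x * ρ * (encGate x)ᴴ) i j
        ∂(Measure.pi fun i => gaussianReal (μ i) (v i)))
    -- Pauli coefficients of `E[ρ']`
    (β : Fin 4 → ℝ) (hβ : ∀ P, β P = ((Eρ * pauli1 P).trace).re) :
    α 0 = 1 ∧ β 0 = 1 ∧
    β 1 ^ 2 + β 2 ^ 2 + β 3 ^ 2 ≤ Real.exp (-σ2) * (α 1 ^ 2 + α 2 ^ 2 + α 3 ^ 2) := by
  have hα0 : α 0 = 1 := by simp [hα, pauli1, htr]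
  have hα1 : α 1 = (ρ * PZ).trace.re := hα 1
  have hα2 : α 2 = (ρ * PX).trace.re := hα 2
  have hα3 : α 3 = (ρ * PY).trace.re := hα 3
  have hbloch := hρ.eq_blochMatrix htr
  rw [← hα1, ← hα2, ← hα3] at hbloch
  rw [hbloch, integral_encGate_conj_blochMatrix] at hE
  have hβ0 : β 0 = 1 := by simp [hβ, pauli1, hE, blochMatrix_trace]
  have hβ1 : β 1 = (Eρ * PZ).trace.re := hβ 1
  have hβ2 : β 2 = (Eρ * PX).trace.re := hβ 2
  have hβ3 : β 3 = (Eρ * PY).trace.re := hβ 3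
  rw [hE, blochMatrix_mul_PZ_trace, Complex.ofReal_re] at hβ1
  rw [hE, blochMatrix_mul_PX_trace, Complex.ofReal_re] at hβ2
  rw [hE, blochMatrix_mul_PY_trace, Complex.ofReal_re] at hβ3
  refine ⟨hα0, hβ0, ?_⟩
  rw [hβ1, hβ2, hβ3]
  have hq : Real.exp (-σ2) ≤ 1 := Real.exp_le_one_iff.mpr (by linarith)
  refine encGate_contraction (C := fun i => ∫ t, Real.cos t ∂gaussianReal (μ i) (v i))
    (S := fun i => ∫ t, Real.sin t ∂gaussianReal (μ i) (v i)) hq (fun i => ?_) _ _ _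
  rw [sq_integral_cos_add_sq_integral_sin_gaussianReal]
  exact Real.exp_le_exp.mpr (neg_le_neg (hv i))
end
end
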